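/- arXiv:2208.06629 — 3 statements merged into one kernel-verified Lean document; each statement's English description precedes it below -/
import Mathlib

section
/- For all integers t and n with 1 ≤ t and 2t ≤ n, U(n) ≤ 2·U(t) + 2·U(n − t) + t. -/
open scoped BigOperators

/-- A lazy transposition on `n` positions, encoded as a triple `(a, b, p)`. -/
abbrev LazyT (n : ℕ) := Fin n × Fin n × ℝ

/-- The triple `(a, b, p)` is a valid lazy transposition: `a ≠ b` and `p ∈ [0,1]`. -/
def LazyT.Valid {n : ℕ} (e : LazyT n) : Prop :=
  e.1 ≠ e.2.1 ∧ 0 ≤ e.2.2 ∧ e.2.2 ≤ 1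

/-- A star transposition: its first coordinate is position `1` (index `0` in `Fin n`). -/
def LazyT.IsStar {n : ℕ} (e : LazyT n) : Prop := (e.1 : ℕ) = 0

/-- `permDist L σ` is the probability that the composition of the independent lazy
transpositions in `L` (applied in order) equals the permutation `σ`. -/
noncomputable def permDist {n : ℕ} : List (LazyT n) → Equiv.Perm (Fin n) → ℝ
  | [], σ => if σ = 1 then 1 else 0
  | e :: L, σ =>
      e.2.2 * permDist L (σ * Equiv.swap e.1 e.2.1) + (1 - e.2.2) * permDist L σ

/-- `L` is a transposition shuffle on `n` points: all entries are valid lazy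
transpositions and the composition is uniformly distributed on `Perm (Fin n)`. -/
def IsShuffle {n : ℕ} (L : List (LazyT n)) : Prop :=
  (∀ e ∈ L, e.Valid) ∧
  ∀ σ : Equiv.Perm (Fin n), permDist L σ = 1 / (n.factorial : ℝ)

/-- `U n` is the minimum length of a transposition shuffle on `n` points. -/
noncomputable def U (n : ℕ) : ℕ :=
  sInf { ℓ : ℕ | ∃ L : List (LazyT n), L.length = ℓ ∧ IsShuffle L }

/-- The probability that, after applying the lazy transpositions in `L`, the `t`
labelled counters starting in positions `1, …, t` end up placed according to the
map `f` (counter `i` in position `f i`). -/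
noncomputable def placeProb {n t : ℕ} (ht : t ≤ n) (L : List (LazyT n))
    (f : Fin t → Fin n) : ℝ :=
  ∑ σ : Equiv.Perm (Fin n),
    if ∀ i : Fin t, σ (Fin.castLE ht i) = f i then permDist L σ else 0

/-- `L` is a `(t,n)`-shuffle: all entries are valid and the final placement of the
`t` counters is uniform over all `n!/(n-t)!` injections. -/
def IsTShuffle {n t : ℕ} (ht : t ≤ n) (L : List (LazyT n)) : Prop :=
  (∀ e ∈ L, e.Valid) ∧
  ∀ f : Fin t → Fin n, Function.Injective f →
    placeProb ht L f = ((n - t).factorial : ℝ) / (n.factorial : ℝ)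

/-- `Ut t n` is the minimum length of a `(t,n)`-shuffle. -/
noncomputable def Ut (t n : ℕ) : ℕ :=
  sInf { ℓ : ℕ | ∃ (ht : t ≤ n) (L : List (LazyT n)), L.length = ℓ ∧ IsTShuffle ht L }

/-- The probability that after applying `L` the set of positions occupied by the
`t` (indistinguishable) counters starting in positions `1, …, t` is exactly `S`. -/
noncomputable def occProb {n t : ℕ} (ht : t ≤ n) (L : List (LazyT n))
    (S : Finset (Fin n)) : ℝ :=
  ∑ σ : Equiv.Perm (Fin n),
    if Finset.image (fun i : Fin t => σ (Fin.castLE ht i)) Finset.univ = S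
    then permDist L σ else 0

/-- `L` shuffles `t` indistinguishable counters over `n` positions: all entries are
valid and the occupied set is uniform over all `n.choose t` subsets of size `t`. -/
def IsIndShuffle {n t : ℕ} (ht : t ≤ n) (L : List (LazyT n)) : Prop :=
  (∀ e ∈ L, e.Valid) ∧
  ∀ S : Finset (Fin n), S.card = t → occProb ht L S = 1 / (n.choose t : ℝ)

/-- `Uhat t n` is the minimum length of a sequence of lazy transpositions shuffling
`t` indistinguishable counters uniformly over `n` positions. -/
noncomputable def Uhat (t n : ℕ) : ℕ :=
  sInf { ℓ : ℕ | ∃ (ht : t ≤ n) (L : List (LazyT n)), L.length = ℓ ∧ IsIndShuffle ht L }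

/-- `Ustar n` is the minimum length of a transposition shuffle on `n` points all of
whose lazy transpositions are star transpositions. -/
noncomputable def Ustar (n : ℕ) : ℕ :=
  sInf { ℓ : ℕ | ∃ L : List (LazyT n), L.length = ℓ ∧ IsShuffle L ∧ ∀ e ∈ L, e.IsStar }

/-- `Utstar t n` is the minimum length of a `(t,n)`-shuffle all of whose lazy
transpositions are star transpositions. -/
noncomputable def Utstar (t n : ℕ) : ℕ :=
  sInf { ℓ : ℕ | ∃ (ht : t ≤ n) (L : List (LazyT n)),
    L.length = ℓ ∧ IsTShuffle ht L ∧ ∀ e ∈ L, e.IsStar }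

open Polynomial in
lemma splits_derivative_real (p : ℝ[X]) (h : p.Splits) : (derivative p).Splits := by
  by_cases h0 : p.natDegree = 0
  · rw [natDegree_eq_zero] at h0
    obtain ⟨c, rfl⟩ := h0
    simp
  rw [splits_iff_card_roots] at h ⊢
  have h1 := card_roots_le_derivative p
  have h2 := card_roots' (derivative p)
  have h3 := natDegree_derivative_lt h0
  omega

open Polynomial in
lemma splits_iterate_derivative_real (k : ℕ) (p : ℝ[X]) (h : p.Splits) :
    (derivative^[k] p).Splits := by
  induction k with
  | zero => simpa
  | succ k ih => rw [Function.iterate_succ_apply']; exact splits_derivative_real _ ih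

open Polynomial in
noncomputable def hgR (t m : ℕ) : ℝ[X] :=
  ∑ k ∈ Finset.range (t + 1), C ((t.choose k * m.choose k : ℕ) : ℝ) * ((X - C 1) ^ k * X ^ (t - k))

open Polynomial in
lemma hgR_rodrigues (t m : ℕ) (h : t ≤ m) :
    derivative^[t] ((X - C 1) ^ t * X ^ m : ℝ[X]) =
      C (t.factorial : ℝ) * X ^ (m - t) * hgR t m := by
  rw [iterate_derivative_mul, hgR, Finset.mul_sum]
  refine Finset.sum_congr rfl fun k hk => ?_
  have hk : k ≤ t := by simpa [Nat.lt_succ_iff] using hk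
  rw [iterate_derivative_X_pow_eq_C_mul, iterate_derivative_X_sub_pow]
  have e1 : t - (t - k) = k := by omega
  have e2 : m - k = (m - t) + (t - k) := by omega
  have e3 : t.choose k * (t.descFactorial (t - k) * m.descFactorial k) =
      t.factorial * (t.choose k * m.choose k) := by
    rw [Nat.descFactorial_eq_factorial_mul_choose, Nat.descFactorial_eq_factorial_mul_choose,
      Nat.choose_symm hk, ← Nat.choose_mul_factorial_mul_factorial hk]
    ring
  rw [e1, e2, pow_add]
  simp only [nsmul_eq_mul]
  have e4 := congrArg (fun n : ℕ => (n : ℝ[X])) e3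
  simp only [Nat.cast_mul] at e4
  simp only [map_natCast, map_mul, Nat.cast_mul]
  linear_combination ((X - C 1) ^ k * (X ^ (m-t) * X ^ (t - k))) * e4

open Polynomial in
lemma hgR_coeff (t m : ℕ) : (hgR t m).coeff t =
    ∑ k ∈ Finset.range (t + 1), ((t.choose k * m.choose k : ℕ) : ℝ) := by
  rw [hgR, finsetSum_coeff]
  refine Finset.sum_congr rfl fun k hk => ?_
  have hk : k ≤ t := by simpa [Nat.lt_succ_iff] using hk
  have hm : ((X - C 1) ^ k * X ^ (t - k) : ℝ[X]).Monic :=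
    ((monic_X_sub_C _).pow k).mul (monic_X_pow _)
  have hd : ((X - C 1) ^ k * X ^ (t - k) : ℝ[X]).natDegree = t := by
    rw [((monic_X_sub_C _).pow k).natDegree_mul (monic_X_pow _), natDegree_pow, natDegree_X_sub_C,
      natDegree_X_pow]
    omega
  have := hm.coeff_natDegree
  rw [hd] at this
  rw [coeff_C_mul, this, mul_one]

open Polynomial in
lemma hgR_natDegree_le (t m : ℕ) : (hgR t m).natDegree ≤ t := by
  refine natDegree_sum_le_of_forall_le _ _ fun k hk => ?_
  have hk : k ≤ t := by simpa [Nat.lt_succ_iff] using hk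
  refine (natDegree_C_mul_le _ _).trans ?_
  rw [((monic_X_sub_C _).pow k).natDegree_mul (monic_X_pow _), natDegree_pow, natDegree_X_sub_C,
      natDegree_X_pow]
  omega

lemma hgZ_pos (t m : ℕ) : 0 < ∑ k ∈ Finset.range (t + 1), ((t.choose k * m.choose k : ℕ) : ℝ) := by
  refine Finset.sum_pos' (fun _ _ => by positivity) ⟨0, by simp, by simp⟩

open Polynomial in
lemma hgR_splits (t m : ℕ) (h : t ≤ m) : (hgR t m).Splits := by
  have h1 : (derivative^[t] ((X - C 1) ^ t * X ^ m : ℝ[X])).Splits := by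
    apply splits_iterate_derivative_real
    exact ((Splits.X_sub_C _).pow _).mul (Splits.X.pow _)
  rw [hgR_rodrigues t m h] at h1
  refine h1.of_dvd ?_ (Dvd.intro_left _ rfl)
  have : hgR t m ≠ 0 := by
    intro h0
    have := hgR_coeff t m
    rw [h0, coeff_zero] at this
    exact (hgZ_pos t m).ne this
  have h3 : (C (t.factorial : ℝ)) ≠ 0 := by simpa using t.factorial_ne_zero
  exact mul_ne_zero (mul_ne_zero h3 (pow_ne_zero _ X_ne_zero)) this

open Polynomial in
lemma hgR_root (t m : ℕ) (h : t ≤ m) (x : ℝ) (hx : (hgR t m).eval x = 0) : 0 ≤ x ∧ x ≤ 1 := by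
  rw [hgR, eval_finsetSum] at hx
  simp only [eval_mul, eval_C, eval_pow, eval_sub, eval_X] at hx
  constructor
  · by_contra! hx0
    have : ∑ k ∈ Finset.range (t + 1), ((t.choose k * m.choose k : ℕ) : ℝ) *
        ((1 - x) ^ k * (-x) ^ (t - k)) = 0 := by
      have h2 := congrArg (fun y => (-1 : ℝ) ^ t * y) hx
      simp only [Finset.mul_sum, mul_zero] at h2
      rw [← h2]
      refine Finset.sum_congr rfl fun k hk => ?_
      have hk : k ≤ t := by simpa [Nat.lt_succ_iff] using hk
      obtain ⟨j, rfl⟩ := Nat.exists_eq_add_of_le hk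
      rw [show 1 - x = (-1) * (x - 1) by ring, show -x = (-1) * x by ring, mul_pow, mul_pow,
        pow_add]
      simp
      ring
    refine this.not_gt (Finset.sum_pos' (fun k _ => ?_) ⟨0, by simp, ?_⟩)
    · have : 0 ≤ 1 - x := by linarith
      have : 0 ≤ -x := by linarith
      positivity
    · have : 0 < -x := by linarith
      simp only [Nat.choose_zero_right, pow_zero]
      positivity
  · by_contra! hx0
    refine hx.not_gt (Finset.sum_pos' (fun k _ => ?_) ⟨0, by simp, ?_⟩)
    · have : 0 ≤ x - 1 := by linarith
      have : 0 ≤ x := by linarith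
      positivity
    · have : 0 < x := by linarith
      simp only [Nat.choose_zero_right, pow_zero]
      positivity

open Polynomial in
lemma exists_pgf (t m : ℕ) (h : t ≤ m) : ∃ r : List ℝ, r.length = t ∧ (∀ p ∈ r, 0 ≤ p ∧ p ≤ 1) ∧
    ∑ k ∈ Finset.range (t + 1), C ((t.choose k * m.choose k : ℕ) : ℝ) * X ^ k =
    C (∑ k ∈ Finset.range (t + 1), ((t.choose k * m.choose k : ℕ) : ℝ)) *
      (r.map fun p => C p * X + C (1 - p)).prod := by
  have hs := hgR_splits t m h
  have hZ := hgZ_pos t m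
  have hc := hgR_coeff t m
  set Z := ∑ k ∈ Finset.range (t + 1), ((t.choose k * m.choose k : ℕ) : ℝ) with hZdef
  have hdeg : (hgR t m).natDegree = t :=
    le_antisymm (hgR_natDegree_le t m) (le_natDegree_of_ne_zero (by rw [hc]; exact hZ.ne'))
  have hlead : (hgR t m).leadingCoeff = Z := by rw [leadingCoeff, hdeg, hc]
  have h0 : hgR t m ≠ 0 := by
    intro h0
    rw [h0] at hlead
    simp at hlead
    exact hZ.ne hlead
  have hlen : (hgR t m).roots.toList.length = t := by
    rw [Multiset.length_toList]
    exact (splits_iff_card_roots.1 hs).trans hdeg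
  refine ⟨(hgR t m).roots.toList, hlen, ?_, ?_⟩
  · intro p hp
    rw [Multiset.mem_toList, mem_roots h0] at hp
    exact hgR_root t m h p hp
  · have hf : ∀ x, (hgR t m).eval x = Z * ((hgR t m).roots.toList.map fun p => x - p).prod := by
      intro x
      conv_lhs => rw [hs.eq_prod_roots, hlead]
      rw [eval_mul, eval_C, eval_multiset_prod, Multiset.map_map]
      congr 1
      conv_lhs => rw [← Multiset.coe_toList (hgR t m).roots]
      rw [Multiset.map_coe, Multiset.prod_coe]
      simp
    generalize (hgR t m).roots.toList = r at hf hlen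
    refine eq_of_infinite_eval_eq _ _ ((Set.Iio_infinite (1 : ℝ)).mono fun y hy => ?_)
    have hy : 0 < 1 - y := by simpa using hy
    have e := hf (1 / (1 - y))
    simp only [Set.mem_ofPred_eq]
    rw [eval_mul, eval_C, eval_list_prod, List.map_map]
    have e1 : ∀ r : List ℝ, (1 - y) ^ r.length * (r.map fun p => 1 / (1 - y) - p).prod =
        (r.map ((eval y) ∘ (fun p => C p * X + C (1 - p)))).prod := by
      intro r
      induction r with
      | nil => simp
      | cons a r ih =>
        simp only [List.map_cons, List.prod_cons, List.length_cons, pow_succ]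
        rw [← ih]
        simp
        field_simp
        ring
    rw [← e1, hlen, mul_left_comm, ← e, hgR, eval_finsetSum, eval_finsetSum, Finset.mul_sum]
    refine Finset.sum_congr rfl fun k hk => ?_
    have hk : k ≤ t := by simpa [Nat.lt_succ_iff] using hk
    obtain ⟨j, rfl⟩ := Nat.exists_eq_add_of_le hk
    simp only [eval_mul, eval_C, eval_pow, eval_sub, eval_X]
    have : 1 / (1 - y) - 1 = y * (1 / (1 - y)) := by field_simp; ring
    rw [this, mul_pow, pow_add, Nat.add_sub_cancel_left]
    have h1 : ∀ i : ℕ, (1 - y) ^ i * (1 / (1 - y)) ^ i = 1 := by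
      intro i
      rw [← mul_pow, mul_one_div_cancel hy.ne', one_pow]
    linear_combination (-(((k + j).choose k * m.choose k : ℕ) : ℝ) * y ^ k) *
      ((1 - y) ^ j * (1 / (1 - y)) ^ j * h1 k + h1 j)

lemma exists_perm_of_card_eq {γ : Type*} [Fintype γ] [DecidableEq γ] (S T : Finset γ)
    (h : S.card = T.card) : ∃ σ : Equiv.Perm γ, ∀ x, x ∈ S ↔ σ x ∈ T := by
  have e : {x // x ∈ S} ≃ {x // x ∈ T} := Fintype.equivOfCardEq (by simpa using h)
  refine ⟨e.extendSubtype, fun x => ⟨fun hx => e.extendSubtype_mem x hx, fun hx => ?_⟩⟩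
  by_contra hn
  exact e.extendSubtype_not_mem x hn hx

section dc
variable {α β : Type*} [Fintype α] [Fintype β] [DecidableEq α] [DecidableEq β]

/-- The set of positions reached from the first block. -/
def img (g : Equiv.Perm (α ⊕ β)) : Finset (α ⊕ β) :=
  Finset.univ.filter fun x => (g⁻¹ x).isLeft = true

lemma mem_img (g : Equiv.Perm (α ⊕ β)) (x : α ⊕ β) : x ∈ img g ↔ (g⁻¹ x).isLeft = true := by
  simp [img]

lemma mem_img_mul (h g : Equiv.Perm (α ⊕ β)) (x : α ⊕ β) : x ∈ img (h * g) ↔ h⁻¹ x ∈ img g := by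
  simp [mem_img, mul_inv_rev]

lemma card_img (g : Equiv.Perm (α ⊕ β)) : (img g).card = Fintype.card α := by
  have : img g = (Finset.univ : Finset α).map (Function.Embedding.inl.trans g.toEmbedding) := by
    ext x
    rw [mem_img]
    simp only [Finset.mem_map, Finset.mem_univ, true_and, Function.Embedding.trans_apply,
      Function.Embedding.inl_apply, Equiv.coe_toEmbedding, Sum.isLeft_iff]
    refine exists_congr fun a => ?_
    rw [Equiv.Perm.inv_eq_iff_eq]
    exact eq_comm
  rw [this, Finset.card_map, Finset.card_univ]

/-- The number of points of the first block sent to the second. -/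
def kk (g : Equiv.Perm (α ⊕ β)) : ℕ := (img g).toRight.card

lemma kk_le (g : Equiv.Perm (α ⊕ β)) : kk g ≤ Fintype.card α := by
  rw [← card_img g, ← Finset.card_toLeft_add_card_toRight]
  exact Nat.le_add_left _ _

lemma double_coset (g g' : Equiv.Perm (α ⊕ β)) (h : kk g = kk g') :
    ∃ a b : Equiv.Perm α × Equiv.Perm β,
      g' = Equiv.Perm.sumCongrHom α β a * g * Equiv.Perm.sumCongrHom α β b := by
  have hl : (img g).toLeft.card = (img g').toLeft.card := by
    have h1 := (img g).card_toLeft_add_card_toRight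
    have h2 := (img g').card_toLeft_add_card_toRight
    rw [card_img] at h1 h2
    unfold kk at h
    omega
  obtain ⟨s, hs⟩ := exists_perm_of_card_eq _ _ hl
  obtain ⟨r, hr⟩ := exists_perm_of_card_eq _ _ h
  have hsr : ∀ x, x ∈ img g ↔ Equiv.Perm.sumCongrHom α β (s, r) x ∈ img g' := by
    rintro (x | x)
    · simpa using hs x
    · simpa using hr x
  have hm : Set.MapsTo (g'⁻¹ * Equiv.Perm.sumCongrHom α β (s, r) * g)
      (Set.range Sum.inl) (Set.range Sum.inl) := by
    rintro _ ⟨a, rfl⟩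
    have h1 : g (Sum.inl a) ∈ img g := by simp [mem_img]
    rw [hsr, mem_img, Sum.isLeft_iff] at h1
    obtain ⟨y, hy⟩ := h1
    exact ⟨y, by simpa using hy.symm⟩
  obtain ⟨b, hb⟩ := Equiv.Perm.mem_sumCongrHom_range_of_perm_mapsTo_inl hm
  refine ⟨(s, r), b⁻¹, ?_⟩
  rw [map_inv, hb]
  group

lemma kk_one : kk (1 : Equiv.Perm (α ⊕ β)) = 0 := by
  simp [kk, Finset.card_eq_zero, Finset.eq_empty_iff_forall_notMem, mem_img]

lemma kk_swap_mul (g : Equiv.Perm (α ⊕ β)) (i : α) (j : β) (hi : g (Sum.inl i) = Sum.inl i)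
    (hj : g (Sum.inr j) = Sum.inr j) :
    kk (Equiv.swap (Sum.inl i) (Sum.inr j) * g) = kk g + 1 := by
  have hi' : g⁻¹ (Sum.inl i) = Sum.inl i := by rw [Equiv.Perm.inv_eq_iff_eq, hi]
  have hj' : g⁻¹ (Sum.inr j) = Sum.inr j := by rw [Equiv.Perm.inv_eq_iff_eq, hj]
  have hn : j ∉ (img g).toRight := by simp [mem_img, hj']
  rw [kk, kk, ← Finset.card_insert_of_notMem hn]
  congr 1
  ext b
  simp only [Finset.mem_toRight, mem_img_mul, Finset.mem_insert, Equiv.swap_inv]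
  by_cases hb : b = j
  · subst hb
    simp [mem_img, hi']
  · rw [Equiv.swap_apply_of_ne_of_ne (by simp) (by simpa using hb)]
    simp [hb]

lemma card_fibre : ∃ c : ℕ, ∀ S : Finset (α ⊕ β), S.card = Fintype.card α →
    (Finset.univ.filter fun g : Equiv.Perm (α ⊕ β) => img g = S).card = c := by
  refine ⟨(Finset.univ.filter fun g : Equiv.Perm (α ⊕ β) => img g = img 1).card, fun S hS => ?_⟩
  obtain ⟨s, hs⟩ := exists_perm_of_card_eq S (img (1 : Equiv.Perm (α ⊕ β)))
    (by rw [hS, card_img])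
  refine Finset.card_equiv (Equiv.mulLeft s) fun g => ?_
  simp only [Finset.mem_filter, Finset.mem_univ, true_and, Equiv.coe_mulLeft]
  constructor
  · intro h
    ext x
    rw [mem_img_mul, h, hs]
    simp
  · intro h
    ext x
    rw [hs, ← h, mem_img_mul]
    simp

lemma card_subsets (k : ℕ) (hk : k ≤ Fintype.card α) :
    (Finset.univ.filter fun S : Finset (α ⊕ β) =>
      S.card = Fintype.card α ∧ S.toRight.card = k).card =
      (Fintype.card α).choose k * (Fintype.card β).choose k := by
  rw [← Nat.choose_symm hk, ← Finset.card_univ, ← Finset.card_univ, ← Finset.card_powersetCard,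
    ← Finset.card_powersetCard k, ← Finset.card_product]
  refine Finset.card_equiv Finset.sumEquiv.toEquiv fun S => ?_
  have h := S.card_toLeft_add_card_toRight
  simp only [Finset.mem_filter, Finset.mem_univ, true_and, Finset.mem_product,
    Finset.mem_powersetCard, Finset.subset_univ, Finset.sumEquiv]
  simp only [Finset.card_univ] at *
  constructor
  · rintro ⟨h1, h2⟩
    exact ⟨show S.toLeft.card = _ by omega, h2⟩
  · rintro ⟨h1, h2⟩
    have h1 : S.toLeft.card = _ := h1
    have h2 : S.toRight.card = _ := h2
    exact ⟨by omega, h2⟩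

lemma card_kk : ∃ c : ℕ, ∀ k ≤ Fintype.card α,
    (Finset.univ.filter fun g : Equiv.Perm (α ⊕ β) => kk g = k).card =
      c * ((Fintype.card α).choose k * (Fintype.card β).choose k) := by
  obtain ⟨c, hc⟩ := card_fibre (α := α) (β := β)
  refine ⟨c, fun k hk => ?_⟩
  rw [← card_subsets k hk, mul_comm, ← smul_eq_mul, ← Finset.sum_const]
  rw [Finset.card_eq_sum_card_fiberwise (f := img)
    (t := Finset.univ.filter fun S : Finset (α ⊕ β) =>
      S.card = Fintype.card α ∧ S.toRight.card = k)]
  · refine Finset.sum_congr rfl fun S hS => ?_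
    simp only [Finset.mem_filter, Finset.mem_univ, true_and] at hS
    rw [← hc S hS.1, Finset.filter_filter]
    congr 1
    ext g
    simp only [Finset.mem_filter, Finset.mem_univ, true_and]
    constructor
    · exact fun h => h.2
    · rintro rfl
      exact ⟨hS.2, rfl⟩
  · intro g hg
    have hg : kk g = k := by simpa using hg
    simpa [card_img, kk] using hg

end dc

section alg

open MonoidAlgebra

/-- The law of one lazy transposition. -/
noncomputable def lz {α : Type*} [DecidableEq α] (e : α × α × ℝ) :
    MonoidAlgebra ℝ (Equiv.Perm α) :=
  single (Equiv.swap e.1 e.2.1) e.2.2 + single 1 (1 - e.2.2)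

/-- The law of a product of lazy transpositions, in the group algebra. -/
noncomputable def DD {α : Type*} [DecidableEq α] :
    List (α × α × ℝ) → MonoidAlgebra ℝ (Equiv.Perm α)
  | [] => 1
  | e :: L => DD L * lz e

/-- The uniform law. -/
noncomputable def unif (α : Type*) [DecidableEq α] [Fintype α] :
    MonoidAlgebra ℝ (Equiv.Perm α) :=
  ∑ g, single g (1 / ((Fintype.card α).factorial : ℝ))

lemma DD_append {α : Type*} [DecidableEq α] (L M : List (α × α × ℝ)) :
    DD (L ++ M) = DD M * DD L := by
  induction L with
  | nil => simp [DD]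
  | cons e L ih => simp [DD, ih, mul_assoc]

/-- Relabelling of lazy transpositions. -/
def mp {α β : Type*} (f : α → β) (e : α × α × ℝ) : β × β × ℝ := (f e.1, f e.2.1, e.2.2)

lemma DD_map {α β : Type*} [DecidableEq α] [DecidableEq β] (f : α → β)
    (φ : Equiv.Perm α →* Equiv.Perm β)
    (h : ∀ a b, φ (Equiv.swap a b) = Equiv.swap (f a) (f b)) (L : List (α × α × ℝ)) :
    DD (L.map (mp f)) = mapDomainRingHom ℝ φ (DD L) := by
  induction L with
  | nil => simp [DD]
  | cons e L ih =>
    simp only [List.map_cons, DD, ih, map_mul]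
    congr 1
    simp [lz, mp, h, mapDomain_add, -single_sub]

lemma permDist_eq {n : ℕ} (L : List (LazyT n)) (σ : Equiv.Perm (Fin n)) :
    permDist L σ = (DD L).coeff σ := by
  induction L generalizing σ with
  | nil => simp [permDist, DD, one_def, Finsupp.single_apply, eq_comm]
  | cons e L ih => simp [permDist, DD, lz, mul_add, ih, -single_sub]; ring

lemma coeff_unif {α : Type*} [DecidableEq α] [Fintype α] (σ : Equiv.Perm α) :
    (unif α).coeff σ = 1 / ((Fintype.card α).factorial : ℝ) := by
  simp [unif, coeff_sum, Finsupp.finsetSum_apply, Finsupp.single_apply]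

lemma DD_eq_unif_iff {n : ℕ} (L : List (LazyT n)) :
    DD L = unif (Fin n) ↔ ∀ σ, permDist L σ = 1 / (n.factorial : ℝ) := by
  simp only [permDist_eq]
  constructor
  · intro h σ
    rw [h, coeff_unif, Fintype.card_fin]
  · intro h
    ext σ
    rw [h, coeff_unif, Fintype.card_fin]

lemma single_mul_unif {α : Type*} [DecidableEq α] [Fintype α] (σ : Equiv.Perm α) (c : ℝ) :
    single σ c * unif α = c • unif α := by
  ext τ
  simp [coeff_unif]

lemma unif_mul_single {α : Type*} [DecidableEq α] [Fintype α] (σ : Equiv.Perm α) (c : ℝ) :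
    unif α * single σ c = c • unif α := by
  ext τ
  simp [coeff_unif, mul_comm]

variable {α β : Type*} [Fintype α] [Fintype β] [DecidableEq α] [DecidableEq β]

/-- The uniform law on the Young subgroup. -/
noncomputable def EE (α β : Type*) [Fintype α] [Fintype β] [DecidableEq α] [DecidableEq β] :
    MonoidAlgebra ℝ (Equiv.Perm (α ⊕ β)) :=
  ∑ x : Equiv.Perm α × Equiv.Perm β, single (Equiv.Perm.sumCongrHom α β x)
    (1 / ((Fintype.card α).factorial : ℝ) * (1 / ((Fintype.card β).factorial : ℝ)))

lemma EE_mul_single (x : Equiv.Perm α × Equiv.Perm β) :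
    EE α β * single (Equiv.Perm.sumCongrHom α β x) 1 = EE α β := by
  rw [EE, Finset.sum_mul]
  simp only [single_mul_single, mul_one, ← map_mul]
  exact Equiv.sum_comp (Equiv.mulRight x) fun y => single (Equiv.Perm.sumCongrHom α β y)
    (1 / ((Fintype.card α).factorial : ℝ) * (1 / ((Fintype.card β).factorial : ℝ)))

lemma single_mul_EE (x : Equiv.Perm α × Equiv.Perm β) :
    single (Equiv.Perm.sumCongrHom α β x) 1 * EE α β = EE α β := by
  rw [EE, Finset.mul_sum]
  simp only [single_mul_single, one_mul, ← map_mul]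
  exact Equiv.sum_comp (Equiv.mulLeft x) fun y => single (Equiv.Perm.sumCongrHom α β y)
    (1 / ((Fintype.card α).factorial : ℝ) * (1 / ((Fintype.card β).factorial : ℝ)))

lemma EE_coeff_sum : ∑ _x : Equiv.Perm α × Equiv.Perm β,
    (1 / ((Fintype.card α).factorial : ℝ) * (1 / ((Fintype.card β).factorial : ℝ))) = 1 := by
  have h1 : ((Fintype.card α).factorial : ℝ) ≠ 0 := by exact_mod_cast Nat.factorial_ne_zero _
  have h2 : ((Fintype.card β).factorial : ℝ) ≠ 0 := by exact_mod_cast Nat.factorial_ne_zero _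
  simp only [Finset.sum_const, Finset.card_univ, Fintype.card_prod, Fintype.card_perm,
    nsmul_eq_mul, Nat.cast_mul]
  field_simp

lemma EE_mul_unif : EE α β * unif (α ⊕ β) = unif (α ⊕ β) := by
  rw [EE, Finset.sum_mul]
  simp only [single_mul_unif]
  rw [← Finset.sum_smul, EE_coeff_sum, one_smul]

lemma unif_mul_EE : unif (α ⊕ β) * EE α β = unif (α ⊕ β) := by
  rw [EE, Finset.mul_sum]
  simp only [unif_mul_single]
  rw [← Finset.sum_smul, EE_coeff_sum, one_smul]

lemma EE_eq (L : List (α × α × ℝ)) (M : List (β × β × ℝ)) (hL : DD L = unif α)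
    (hM : DD M = unif β) :
    DD (L.map (mp Sum.inl) ++ M.map (mp Sum.inr)) = EE α β := by
  rw [DD_append,
    DD_map Sum.inl ((Equiv.Perm.sumCongrHom α β).comp (MonoidHom.inl _ _))
      (fun a b => by simp [← Equiv.Perm.sumCongr_swap_one]),
    DD_map Sum.inr ((Equiv.Perm.sumCongrHom α β).comp (MonoidHom.inr _ _))
      (fun a b => by simp [← Equiv.Perm.sumCongr_one_swap]), hL, hM]
  rw [unif, unif, map_sum, map_sum, Finset.sum_mul_sum, Finset.sum_comm, EE,
    Fintype.sum_prod_type]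
  refine Finset.sum_congr rfl fun a _ => Finset.sum_congr rfl fun b _ => ?_
  simp [single_mul_single, mul_comm]

lemma EE_single_congr (g g' : Equiv.Perm (α ⊕ β)) (h : kk g = kk g') :
    EE α β * single g 1 * EE α β = EE α β * single g' 1 * EE α β := by
  obtain ⟨a, b, rfl⟩ := double_coset g g' h
  have : (single (Equiv.Perm.sumCongrHom α β a * g * Equiv.Perm.sumCongrHom α β b) 1 :
      MonoidAlgebra ℝ (Equiv.Perm (α ⊕ β))) =
      single (Equiv.Perm.sumCongrHom α β a) 1 * single g 1 *
        single (Equiv.Perm.sumCongrHom α β b) 1 := by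
    simp only [single_mul_single, mul_one]
  rw [this, mul_assoc, mul_assoc, mul_assoc, mul_assoc, single_mul_EE, ← mul_assoc, ← mul_assoc,
    ← mul_assoc, EE_mul_single]

lemma exists_W : ∃ W : ℕ → MonoidAlgebra ℝ (Equiv.Perm (α ⊕ β)), ∀ g,
    EE α β * single g 1 * EE α β = W (kk g) := by
  classical
  refine ⟨fun k => if h : ∃ g : Equiv.Perm (α ⊕ β), kk g = k then
    EE α β * single h.choose 1 * EE α β else 0, fun g => ?_⟩
  have h : ∃ g' : Equiv.Perm (α ⊕ β), kk g' = kk g := ⟨g, rfl⟩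
  simp only [dif_pos h]
  exact EE_single_congr _ _ h.choose_spec.symm

/-- Cross transpositions between the blocks. -/
def cr (e : α × β × ℝ) : (α ⊕ β) × (α ⊕ β) × ℝ := (Sum.inl e.1, Sum.inr e.2.1, e.2.2)

open Polynomial in
lemma cross_formula (W : ℕ → MonoidAlgebra ℝ (Equiv.Perm (α ⊕ β)))
    (hW : ∀ g, EE α β * MonoidAlgebra.single g 1 * EE α β = W (kk g))
    (Ψ : ℝ[X] →ₗ[ℝ] MonoidAlgebra ℝ (Equiv.Perm (α ⊕ β))) (hΨ : ∀ k, Ψ (X ^ k) = W k)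
    (L : List (α × β × ℝ)) (h1 : (L.map fun e => e.1).Nodup) (h2 : (L.map fun e => e.2.1).Nodup)
    (g : Equiv.Perm (α ⊕ β))
    (hg : ∀ e ∈ L, g (Sum.inl e.1) = Sum.inl e.1 ∧ g (Sum.inr e.2.1) = Sum.inr e.2.1) :
    EE α β * DD (L.map cr) * MonoidAlgebra.single g 1 * EE α β =
      Ψ (X ^ (kk g) * ((L.map fun e => e.2.2).map fun p => C p * X + C (1 - p)).prod) := by
  induction L generalizing g with
  | nil => simp [DD, hΨ, hW]
  | cons e L ih =>
    obtain ⟨i, j, p⟩ := e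
    simp only [List.map_cons, List.nodup_cons] at h1 h2
    have hij := hg (i, j, p) (by simp)
    have ih1 := ih h1.2 h2.2 g fun e he => hg e (by simp [he])
    have ih2 := ih h1.2 h2.2 (Equiv.swap (Sum.inl i) (Sum.inr j) * g) fun e he => by
      have := hg e (by simp [he])
      have n1 : e.1 ≠ i := fun h => h1.1 (List.mem_map.2 ⟨e, he, h⟩)
      have n2 : e.2.1 ≠ j := fun h => h2.1 (List.mem_map.2 ⟨e, he, h⟩)
      rw [Equiv.Perm.mul_apply, Equiv.Perm.mul_apply, this.1, this.2,
        Equiv.swap_apply_of_ne_of_ne (by simpa using n1) (by simp),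
        Equiv.swap_apply_of_ne_of_ne (by simp) (by simpa using n2)]
      simp
    rw [kk_swap_mul g i j hij.1 hij.2] at ih2
    simp only [List.map_cons, List.prod_cons, DD]
    have e1 : (lz (cr (i, j, p)) * MonoidAlgebra.single g 1 :
        MonoidAlgebra ℝ (Equiv.Perm (α ⊕ β))) =
        p • MonoidAlgebra.single (Equiv.swap (Sum.inl i) (Sum.inr j) * g) 1 +
        (1 - p) • MonoidAlgebra.single g 1 := by
      simp only [lz, cr, add_mul, MonoidAlgebra.single_mul_single, MonoidAlgebra.smul_single,
        smul_eq_mul, mul_one, one_mul]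
    generalize hQ : ((L.map fun e => e.2.2).map fun p => C p * X + C (1 - p)).prod = Q at *
    have e2 : (X ^ (kk g) * ((C p * X + C (1 - p)) * Q)) =
        p • (X ^ (kk g + 1) * Q) + (1 - p) • (X ^ (kk g) * Q) := by
      simp only [smul_eq_C_mul]
      ring
    rw [e2, map_add, map_smul, map_smul, ← ih1, ← ih2]
    rw [← mul_assoc (EE α β) (DD _) (lz _), mul_assoc _ (lz _) _, e1]
    simp only [mul_add, add_mul, mul_smul_comm, smul_mul_assoc]

open Polynomial in
lemma core (L : List (α × β × ℝ)) (h1 : (L.map fun e => e.1).Nodup)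
    (h2 : (L.map fun e => e.2.1).Nodup)
    (hP : ∑ k ∈ Finset.range (Fintype.card α + 1),
        C (((Fintype.card α).choose k * (Fintype.card β).choose k : ℕ) : ℝ) * X ^ k =
      C (∑ k ∈ Finset.range (Fintype.card α + 1),
        (((Fintype.card α).choose k * (Fintype.card β).choose k : ℕ) : ℝ)) *
      ((L.map fun e => e.2.2).map fun p => C p * X + C (1 - p)).prod) :
    EE α β * DD (L.map cr) * EE α β = unif (α ⊕ β) := by
  obtain ⟨W, hW⟩ := exists_W (α := α) (β := β)
  obtain ⟨Ψ, hΨ⟩ : ∃ Ψ : ℝ[X] →ₗ[ℝ] MonoidAlgebra ℝ (Equiv.Perm (α ⊕ β)),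
      ∀ k, Ψ (X ^ k) = W k := by
    refine ⟨(Polynomial.basisMonomials ℝ).constr ℝ W, fun k => ?_⟩
    have := (Polynomial.basisMonomials ℝ).constr_basis ℝ W k
    rw [coe_basisMonomials] at this
    rw [← monomial_one_right_eq_X_pow]
    exact this
  have hc := cross_formula W hW Ψ hΨ L h1 h2 1 (by simp)
  rw [← MonoidAlgebra.one_def, mul_one, kk_one, pow_zero, one_mul] at hc
  rw [hc]
  generalize ((L.map fun e => e.2.2).map fun p => C p * X + C (1 - p)).prod = Q at hP ⊢
  have hP' := congrArg Ψ hP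
  rw [← smul_eq_C_mul, map_smul, map_sum] at hP'
  simp only [← smul_eq_C_mul, map_smul, hΨ] at hP'
  obtain ⟨c, hcard⟩ := card_kk (α := α) (β := β)
  have hu : unif (α ⊕ β) = (1 / ((Fintype.card (α ⊕ β)).factorial : ℝ)) •
      ∑ k ∈ Finset.range (Fintype.card α + 1),
        ((c * ((Fintype.card α).choose k * (Fintype.card β).choose k) : ℕ) : ℝ) • W k := by
    have hmaps : ∀ g ∈ (Finset.univ : Finset (Equiv.Perm (α ⊕ β))),
        kk g ∈ Finset.range (Fintype.card α + 1) := fun g _ => by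
      simpa [Nat.lt_succ_iff] using kk_le g
    calc unif (α ⊕ β) = EE α β * unif (α ⊕ β) * EE α β := by rw [EE_mul_unif, unif_mul_EE]
      _ = (1 / ((Fintype.card (α ⊕ β)).factorial : ℝ)) • ∑ g : Equiv.Perm (α ⊕ β), W (kk g) := by
        rw [unif, Finset.mul_sum, Finset.sum_mul, Finset.smul_sum]
        refine Finset.sum_congr rfl fun g _ => ?_
        rw [← hW, ← smul_mul_assoc, ← mul_smul_comm, MonoidAlgebra.smul_single, smul_eq_mul,
          mul_one]
      _ = _ := by
        congr 1
        rw [← Finset.sum_fiberwise_of_maps_to hmaps]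
        refine Finset.sum_congr rfl fun k hk => ?_
        rw [← hcard k (by simpa [Nat.lt_succ_iff] using hk), Nat.cast_smul_eq_nsmul]
        rw [← Finset.sum_const]
        refine Finset.sum_congr rfl fun g hg => ?_
        rw [(Finset.mem_filter.1 hg).2]
  have hn : (Fintype.card (α ⊕ β)).factorial =
      c * ∑ k ∈ Finset.range (Fintype.card α + 1),
        ((Fintype.card α).choose k * (Fintype.card β).choose k) := by
    rw [← Fintype.card_perm, ← Finset.card_univ, Finset.card_eq_sum_card_fiberwise (f := kk)
      (t := Finset.range (Fintype.card α + 1)), Finset.mul_sum]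
    · exact Finset.sum_congr rfl fun k hk => hcard k (by simpa [Nat.lt_succ_iff] using hk)
    · intro g _
      simpa [Nat.lt_succ_iff] using kk_le g
  have hn0 : ((Fintype.card (α ⊕ β)).factorial : ℝ) ≠ 0 := by
    exact_mod_cast Nat.factorial_ne_zero _
  rw [hu]
  simp only [Nat.cast_mul c, mul_smul]
  rw [← Finset.smul_sum, hP', smul_smul, smul_smul, mul_assoc, ← Nat.cast_sum, ← Nat.cast_mul,
    ← hn, one_div, inv_mul_cancel₀ hn0, one_smul]

end alg

lemma shuffle_step (t m : ℕ) (h : t ≤ m) (L : List (LazyT t)) (M : List (LazyT m))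
    (hL : IsShuffle L) (hM : IsShuffle M) :
    ∃ K : List (LazyT (t + m)), K.length = 2 * L.length + 2 * M.length + t ∧ IsShuffle K := by
  obtain ⟨r, hr, hr01, hP⟩ := exists_pgf t m h
  let T : List (Fin t × Fin m × ℝ) :=
    List.ofFn fun i : Fin t => (i, Fin.castLE h i, r.get (i.cast hr.symm))
  have hT1 : (T.map fun e => e.1).Nodup := by
    simp only [T, List.map_ofFn]
    exact List.nodup_ofFn.2 fun a b hab => hab
  have hT2 : (T.map fun e => e.2.1).Nodup := by
    simp only [T, List.map_ofFn]
    exact List.nodup_ofFn.2 fun a b hab => Fin.castLE_injective h hab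
  have hT3 : (T.map fun e => e.2.2) = r := by
    subst hr
    simp only [T, List.map_ofFn]
    exact List.ofFn_get r
  let A := L.map (mp (Sum.inl : Fin t → Fin t ⊕ Fin m)) ++ M.map (mp Sum.inr)
  have hA : DD A = EE (Fin t) (Fin m) :=
    EE_eq L M ((DD_eq_unif_iff L).2 hL.2) ((DD_eq_unif_iff M).2 hM.2)
  have hcore := core T hT1 hT2 (by simpa only [hT3, Fintype.card_fin] using hP)
  have hD : DD (A ++ (T.map cr ++ A)) = unif (Fin t ⊕ Fin m) := by
    rw [DD_append, DD_append, hA, hcore]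
  refine ⟨(A ++ (T.map cr ++ A)).map (mp finSumFinEquiv), ?_, ?_, ?_⟩
  · simp [A, T]
    ring
  · have hv : ∀ e ∈ A ++ (T.map cr ++ A), e.1 ≠ e.2.1 ∧ 0 ≤ e.2.2 ∧ e.2.2 ≤ 1 := by
      have hvA : ∀ e ∈ A, e.1 ≠ e.2.1 ∧ 0 ≤ e.2.2 ∧ e.2.2 ≤ 1 := by
        intro e he
        rcases List.mem_append.1 he with he | he
        · obtain ⟨x, hx, rfl⟩ := List.mem_map.1 he
          have := hL.1 x hx
          exact ⟨fun h => this.1 (Sum.inl_injective h), this.2⟩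
        · obtain ⟨x, hx, rfl⟩ := List.mem_map.1 he
          have := hM.1 x hx
          exact ⟨fun h => this.1 (Sum.inr_injective h), this.2⟩
      intro e he
      rcases List.mem_append.1 he with he | he
      · exact hvA e he
      rcases List.mem_append.1 he with he | he
      · obtain ⟨x, hx, rfl⟩ := List.mem_map.1 he
        refine ⟨by simp [cr], hr01 x.2.2 ?_⟩
        rw [← hT3]
        exact List.mem_map.2 ⟨x, hx, rfl⟩
      · exact hvA e he
    intro e he
    obtain ⟨x, hx, rfl⟩ := List.mem_map.1 he
    have := hv x hx
    exact ⟨fun h => this.1 (finSumFinEquiv.injective h), this.2⟩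
  · rw [← DD_eq_unif_iff, DD_map finSumFinEquiv
      (finSumFinEquiv.permCongrHom : Equiv.Perm (Fin t ⊕ Fin m) ≃* _).toMonoidHom, hD]
    · rw [unif, map_sum, unif]
      have := (finSumFinEquiv.permCongrHom :
        Equiv.Perm (Fin t ⊕ Fin m) ≃* Equiv.Perm (Fin (t + m))).toEquiv.sum_comp
        fun g => MonoidAlgebra.single g (1 / ((Fintype.card (Fin (t + m))).factorial : ℝ))
      rw [← this]
      refine Finset.sum_congr rfl fun g _ => ?_
      simp
    · intro a b
      ext x
      simp [Equiv.permCongrHom, Equiv.permCongr_apply, Equiv.swap_apply_def,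
        Equiv.symm_apply_eq]
      split_ifs <;> simp

lemma exists_shuffle (n : ℕ) : ∃ L : List (LazyT n), IsShuffle L := by
  have h1 : ∀ n, n ≤ 1 → IsShuffle ([] : List (LazyT n)) := by
    intro n hn
    refine ⟨by simp, fun σ => ?_⟩
    interval_cases n <;> simp [permDist, Subsingleton.elim σ 1]
  induction n with
  | zero => exact ⟨[], h1 0 (by simp)⟩
  | succ m ih =>
    by_cases hm : 1 ≤ m
    · obtain ⟨L, hL⟩ := ih
      obtain ⟨K, _, hK⟩ := shuffle_step 1 m hm [] L (h1 1 le_rfl) hL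
      rw [add_comm]
      exact ⟨K, hK⟩
    · exact ⟨[], h1 _ (by omega)⟩

lemma exists_U (n : ℕ) : ∃ L : List (LazyT n), L.length = U n ∧ IsShuffle L := by
  obtain ⟨L, hL⟩ := exists_shuffle n
  exact Nat.sInf_mem (s := { ℓ : ℕ | ∃ L : List (LazyT n), L.length = ℓ ∧ IsShuffle L })
    ⟨L.length, L, rfl, hL⟩

theorem divide_and_conquer_U (t n : ℕ) (ht : 1 ≤ t) (hn : 2 * t ≤ n) :
    U n ≤ 2 * U t + 2 * U (n - t) + t := by
  obtain ⟨m, rfl⟩ := Nat.exists_eq_add_of_le (show t ≤ n by omega)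
  rw [Nat.add_sub_cancel_left]
  obtain ⟨L, hL, hL'⟩ := exists_U t
  obtain ⟨M, hM, hM'⟩ := exists_U m
  rw [← hL, ← hM]
  exact Nat.sInf_le (shuffle_step t m (by omega) L M hL' hM')
end

section
/- For every integer k ≥ 3, Û_3(2k) ≤ 2k + 2 + Û_3(k). -/
open scoped BigOperators

namespace UhatThree

open Finset

/-- Expected value of `g` at the final occupied set, starting from `S`. -/
noncomputable def E {α : Type} [DecidableEq α] :
    List (α × α × ℝ) → (Finset α → ℝ) → Finset α → ℝ
  | [], g, S => g S
  | e :: L, g, S =>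
      e.2.2 * E L g (S.image (Equiv.swap e.1 e.2.1)) + (1 - e.2.2) * E L g S

/-- Sum of `g` over ordered triples of distinct elements. -/
noncomputable def T3 {α : Type} [DecidableEq α] [Fintype α] (g : Finset α → ℝ) : ℝ :=
  ∑ x : α, ∑ y : α, ∑ w : α, if x ≠ y ∧ x ≠ w ∧ y ≠ w then g {x, y, w} else 0

lemma E_append {α : Type} [DecidableEq α] (L M : List (α × α × ℝ)) (g : Finset α → ℝ)
    (S : Finset α) : E (L ++ M) g S = E L (E M g) S := by
  induction L generalizing S with
  | nil => rfl
  | cons e L ih => simp only [List.cons_append, E, ih]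

lemma E_permDist {n : ℕ} (L : List (LazyT n)) (g : Finset (Fin n) → ℝ) (S : Finset (Fin n)) :
    ∑ σ : Equiv.Perm (Fin n), permDist L σ * g (S.image σ) = E L g S := by
  induction L generalizing S with
  | nil => simp [permDist, E]
  | cons e L ih =>
    simp only [permDist, E, ← ih, add_mul, sum_add_distrib, mul_sum]
    congr 1
    · rw [← Equiv.sum_comp (Equiv.mulRight (Equiv.swap e.1 e.2.1))]
      refine sum_congr rfl fun σ _ => ?_
      simp only [Equiv.coe_mulRight, mul_assoc, Equiv.swap_mul_self, mul_one, image_image]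
      rfl
    · exact sum_congr rfl fun σ _ => by ring

lemma E_embed {α β : Type} [DecidableEq α] [DecidableEq β] (φ : α → β)
    (hφ : Function.Injective φ) (R : Finset β) (hR : ∀ a, φ a ∉ R)
    (L : List (α × α × ℝ)) (g : Finset β → ℝ) (S : Finset α) :
    E (L.map fun e => (φ e.1, φ e.2.1, e.2.2)) g (S.image φ ∪ R)
      = E L (fun S => g (S.image φ ∪ R)) S := by
  induction L generalizing S with
  | nil => rfl
  | cons e L ih =>
    have : (S.image φ ∪ R).image (Equiv.swap (φ e.1) (φ e.2.1))
        = (S.image (Equiv.swap e.1 e.2.1)).image φ ∪ R := by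
      rw [image_union, image_image, image_image]
      congr 1
      · refine image_congr fun x _ => ?_
        simp only [Function.comp]
        rw [hφ.map_swap]
      · ext x
        simp only [mem_image]
        constructor
        · rintro ⟨y, hy, rfl⟩
          rw [Equiv.swap_apply_of_ne_of_ne] <;> first | exact hy | (rintro rfl; exact hR _ hy)
        · intro hx
          refine ⟨x, hx, ?_⟩
          rw [Equiv.swap_apply_of_ne_of_ne] <;> (rintro rfl; exact hR _ hx)
    simp only [List.map_cons, E, this, ih]

lemma E_erase {α : Type} [DecidableEq α] (L : List (α × α × ℝ)) (f : Finset α → ℝ)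
    (S : Finset α) :
    E L (fun S => ∑ i ∈ S, f (S.erase i)) S = ∑ i ∈ S, E L f (S.erase i) := by
  induction L generalizing S with
  | nil => rfl
  | cons e L ih =>
    simp only [E, ih, sum_add_distrib, mul_sum]
    congr 1
    rw [sum_image (fun x _ y _ h => (Equiv.swap e.1 e.2.1).injective h)]
    refine sum_congr rfl fun i _ => ?_
    rw [image_erase (Equiv.swap e.1 e.2.1).injective]

lemma E_fix {α : Type} [DecidableEq α] (L : List (α × α × ℝ)) (g : Finset α → ℝ)
    (S : Finset α) (h : ∀ e ∈ L, e.1 ∉ S ∧ e.2.1 ∉ S) : E L g S = g S := by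
  induction L with
  | nil => rfl
  | cons e L ih =>
    have h1 := h e (by simp)
    have : S.image (Equiv.swap e.1 e.2.1) = S := by
      conv_rhs => rw [← image_id (s := S)]
      refine image_congr fun x hx => ?_
      rw [Equiv.swap_apply_of_ne_of_ne] <;> first | rfl | (rintro rfl; simp_all)
    simp only [E, this, ih (fun e he => h e (by simp [he]))]
    ring

lemma T3_E {α : Type} [DecidableEq α] [Fintype α] (L : List (α × α × ℝ)) (g : Finset α → ℝ) :
    T3 (E L g) = T3 g := by
  induction L with
  | nil => rfl
  | cons e L ih =>
    have h1 : T3 (fun S => E L g (S.image (Equiv.swap e.1 e.2.1))) = T3 (E L g) := by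
      unfold T3
      rw [← Equiv.sum_comp (Equiv.swap e.1 e.2.1)]
      refine sum_congr rfl fun x _ => ?_
      rw [← Equiv.sum_comp (Equiv.swap e.1 e.2.1)]
      refine sum_congr rfl fun y _ => ?_
      rw [← Equiv.sum_comp (Equiv.swap e.1 e.2.1)]
      refine sum_congr rfl fun w _ => ?_
      simp only [ne_eq, EmbeddingLike.apply_eq_iff_eq, image_insert, image_singleton,
        Equiv.swap_apply_self, Equiv.swap_swap]
    have h2 : T3 (E (e :: L) g) = e.2.2 * T3 (fun S => E L g (S.image (Equiv.swap e.1 e.2.1)))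
        + (1 - e.2.2) * T3 (E L g) := by
      simp only [T3, mul_sum, ← sum_add_distrib, E]
      refine sum_congr rfl fun x _ => sum_congr rfl fun y _ => sum_congr rfl fun w _ => ?_
      split_ifs <;> simp
    rw [h2, h1, ih]; ring

lemma T3_eq {α : Type} [DecidableEq α] [Fintype α] (g : Finset α → ℝ) :
    T3 g = 6 * ∑ S ∈ powersetCard 3 (univ : Finset α), g S := by
  have key : ∀ S ∈ powersetCard 3 (univ : Finset α),
      (∑ x : α, ∑ y : α, ∑ w : α,
        if (x ≠ y ∧ x ≠ w ∧ y ≠ w) ∧ ({x, y, w} : Finset α) = S then (1:ℝ) else 0) = 6 := by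
    intro S hS
    obtain ⟨a, b, c, hab, hac, hbc, rfl⟩ := card_eq_three.1 (mem_powersetCard.1 hS).2
    simp only [← Fintype.sum_prod_type']
    rw [sum_boole]
    have : (univ.filter fun p : α × α × α => (p.1 ≠ p.2.1 ∧ p.1 ≠ p.2.2 ∧ p.2.1 ≠ p.2.2) ∧
        ({p.1, p.2.1, p.2.2} : Finset α) = {a, b, c})
        = {(a,b,c),(a,c,b),(b,a,c),(b,c,a),(c,a,b),(c,b,a)} := by
      ext ⟨x, y, w⟩
      simp only [mem_filter, mem_univ, true_and, mem_insert, mem_singleton, Prod.mk.injEq]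
      constructor
      · rintro ⟨⟨h1, h2, h3⟩, h⟩
        have hx : x ∈ ({a, b, c} : Finset α) := by rw [← h]; simp
        have hy : y ∈ ({a, b, c} : Finset α) := by rw [← h]; simp
        have hw : w ∈ ({a, b, c} : Finset α) := by rw [← h]; simp
        simp only [mem_insert, mem_singleton] at hx hy hw
        grind
      · rintro (⟨rfl, rfl, rfl⟩ | ⟨rfl, rfl, rfl⟩ | ⟨rfl, rfl, rfl⟩ | ⟨rfl, rfl, rfl⟩ |
          ⟨rfl, rfl, rfl⟩ | ⟨rfl, rfl, rfl⟩) <;>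
        · refine ⟨by grind, ?_⟩
          ext t
          simp only [mem_insert, mem_singleton]
          try tauto
    rw [this]
    rw [card_insert_of_notMem, card_insert_of_notMem, card_insert_of_notMem,
      card_insert_of_notMem, card_insert_of_notMem, card_singleton]
    · norm_num
    all_goals simp only [mem_insert, mem_singleton, Prod.mk.injEq]; grind
  have e1 : 6 * ∑ S ∈ powersetCard 3 (univ : Finset α), g S
      = ∑ S ∈ powersetCard 3 (univ : Finset α), (∑ x : α, ∑ y : α, ∑ w : α,
        if (x ≠ y ∧ x ≠ w ∧ y ≠ w) ∧ ({x, y, w} : Finset α) = S then (1:ℝ) else 0) * g S := by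
    rw [mul_sum]
    exact sum_congr rfl fun S hS => by rw [key S hS]
  rw [e1]
  simp only [sum_mul]
  rw [T3, sum_comm (s := powersetCard 3 univ)]
  refine sum_congr rfl fun x _ => ?_
  rw [sum_comm (s := powersetCard 3 univ)]
  refine sum_congr rfl fun y _ => ?_
  rw [sum_comm (s := powersetCard 3 univ)]
  refine sum_congr rfl fun w _ => ?_
  split_ifs with h
  · rw [sum_eq_single ({x, y, w} : Finset α)]
    · rw [if_pos ⟨h, rfl⟩, one_mul]
    · intro S _ hS
      rw [if_neg (fun h' => hS h'.2.symm), zero_mul]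
    · intro hn
      exact absurd (mem_powersetCard.2 ⟨subset_univ _, card_eq_three.2
        ⟨x, y, w, h.1, h.2.1, h.2.2, rfl⟩⟩) hn
  · symm
    exact sum_eq_zero fun S _ => by rw [if_neg (fun h' => h h'.1), zero_mul]

/-- The functional form of being a shuffle of three counters starting at `a, b, c`. -/
def Sh {α : Type} [DecidableEq α] [Fintype α] (L : List (α × α × ℝ)) (a b c : α) : Prop :=
  (∀ e ∈ L, e.1 ≠ e.2.1 ∧ 0 ≤ e.2.2 ∧ e.2.2 ≤ 1) ∧
  ∀ g : Finset α → ℝ, (Fintype.card α : ℝ) * (Fintype.card α - 1) * (Fintype.card α - 2) *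
    E L g {a, b, c} = T3 g

lemma occ_eq {n : ℕ} (ht : 3 ≤ n) (L : List (LazyT n)) (S : Finset (Fin n)) :
    occProb ht L S = E L (fun T => if T = S then 1 else 0)
      {⟨0, by omega⟩, ⟨1, by omega⟩, ⟨2, by omega⟩} := by
  rw [← E_permDist]
  unfold occProb
  refine sum_congr rfl fun σ _ => ?_
  have : Finset.image (fun i : Fin 3 => σ (Fin.castLE ht i)) Finset.univ
    = image σ {⟨0, by omega⟩, ⟨1, by omega⟩, ⟨2, by omega⟩} := by
    have : (univ : Finset (Fin 3)) = {0, 1, 2} := by decide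
    rw [this]
    simp only [image_insert, image_singleton]
    rfl
  rw [this]
  split_ifs <;> simp

lemma choose3 (n : ℕ) : (n.choose 3 : ℝ) * 6 = (n:ℝ) * (n - 1) * (n - 2) := by
  rw [Nat.cast_choose_eq_descPochhammer_div]
  simp [descPochhammer_succ_right, Nat.factorial]

lemma npos {n : ℕ} (h : 3 ≤ n) : (0:ℝ) < (n:ℝ) * (n - 1) * (n - 2) := by
  have : (3:ℝ) ≤ n := by exact_mod_cast h
  have h1 : (0:ℝ) < n - 1 := by linarith
  have h2 : (0:ℝ) < n - 2 := by linarith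
  positivity

lemma sh_iff {n : ℕ} (ht : 3 ≤ n) (L : List (LazyT n)) :
    IsIndShuffle ht L ↔ Sh L ⟨0, by omega⟩ ⟨1, by omega⟩ ⟨2, by omega⟩ := by
  unfold IsIndShuffle Sh
  refine and_congr Iff.rfl ?_
  have hN := npos ht
  have hC := choose3 n
  have hC0 : (n.choose 3 : ℝ) ≠ 0 := by
    intro h; rw [h] at hC; linarith
  simp only [occ_eq, Fintype.card_fin]
  constructor
  · intro h g
    have : E L g {⟨0, by omega⟩, ⟨1, by omega⟩, ⟨2, by omega⟩}
        = ∑ S ∈ powersetCard 3 (univ : Finset (Fin n)), g S * (1 / (n.choose 3 : ℝ)) := by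
      rw [← E_permDist]
      have : ∀ S ∈ powersetCard 3 (univ : Finset (Fin n)), g S * (1 / (n.choose 3 : ℝ))
          = g S * E L (fun T => if T = S then 1 else 0)
            {⟨0, by omega⟩, ⟨1, by omega⟩, ⟨2, by omega⟩} := by
        intro S hS
        rw [h S (mem_powersetCard.1 hS).2]
      rw [sum_congr rfl this]
      simp only [← E_permDist, mul_sum]
      rw [sum_comm]
      refine sum_congr rfl fun σ _ => ?_
      rw [sum_eq_single (image σ {⟨0, by omega⟩, ⟨1, by omega⟩, ⟨2, by omega⟩})]
      · simp [mul_comm]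
      · intro b _ hb
        rw [if_neg (Ne.symm hb)]; simp
      · intro hn
        refine absurd (mem_powersetCard.2 ⟨subset_univ _, ?_⟩) hn
        rw [card_image_of_injective _ σ.injective]
        exact card_eq_three.2 ⟨_, _, _, by simp, by simp, by simp, rfl⟩
    rw [this, T3_eq, ← hC, ← sum_mul]
    field_simp
  · intro h S hS
    have := h (fun T => if T = S then 1 else 0)
    rw [T3_eq, ← hC] at this
    rw [sum_ite_eq' (powersetCard 3 univ) S, if_pos (mem_powersetCard.2 ⟨subset_univ _, hS⟩)] at this
    rw [eq_div_iff hC0]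
    linarith

lemma sum_third {n : ℕ} (f : Fin n → Fin n → ℝ) :
    (∑ x : Fin n, ∑ y : Fin n, ∑ w : Fin n, if x ≠ y ∧ x ≠ w ∧ y ≠ w then f x y else 0)
      = ((n:ℝ) - 2) * ∑ x : Fin n, ∑ y : Fin n, if x ≠ y then f x y else 0 := by
  simp only [mul_sum]
  refine sum_congr rfl fun x _ => sum_congr rfl fun y _ => ?_
  by_cases h : x = y
  · simp [h]
  · have : ∀ w, (if x ≠ y ∧ x ≠ w ∧ y ≠ w then f x y else 0)
        = f x y - (if w = x then f x y else 0) - (if w = y then f x y else 0) := by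
      intro w
      grind
    simp only [this, sum_sub_distrib, sum_ite_eq', mem_univ, if_true, sum_const, card_univ,
      Fintype.card_fin, nsmul_eq_mul, if_pos (show x ≠ y from h)]
    ring

/-- The common initial segment of the constructions. -/
noncomputable def pre {n : ℕ} {α : Type} (φ : Fin n → α) (a b c : Fin n) (z : α) (q : ℝ)
    (L : List (LazyT n)) : List (α × α × ℝ) :=
  (φ c, z, q) :: (φ c, φ a, 1/3) :: (φ c, φ b, 1/2) ::
    L.map fun e => (φ e.1, φ e.2.1, e.2.2)

lemma pre_eq {n : ℕ} (hn : 3 ≤ n) {α : Type} [DecidableEq α] (φ : Fin n → α)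
    (hφ : Function.Injective φ) (z : α) (hz : ∀ i, φ i ≠ z) (q : ℝ) (a b c : Fin n)
    (hab : a ≠ b) (hac : a ≠ c) (hbc : b ≠ c) (L : List (LazyT n)) (hL : Sh L a b c)
    (g : Finset α → ℝ) :
    E (pre φ a b c z q L) g {φ a, φ b, φ c}
      = (1 - q) / ((n:ℝ) * (n - 1) * (n - 2)) *
          (∑ x : Fin n, ∑ y : Fin n, ∑ w : Fin n,
            if x ≠ y ∧ x ≠ w ∧ y ≠ w then g {φ x, φ y, φ w} else 0)
        + q / ((n:ℝ) * (n - 1)) *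
          (∑ x : Fin n, ∑ y : Fin n, if x ≠ y then g {φ x, φ y, z} else 0) := by
  have hab' := hφ.ne hab
  have hac' := hφ.ne hac
  have hbc' := hφ.ne hbc
  have hza := hz a
  have hzb := hz b
  have hzc := hz c
  set M := L.map fun e => (φ e.1, φ e.2.1, e.2.2) with hM
  have i1 : ({φ a, φ b, φ c} : Finset α).image (Equiv.swap (φ c) z) = {φ a, φ b, z} := by
    simp only [image_insert, image_singleton, Equiv.swap_apply_left]
    rw [Equiv.swap_apply_of_ne_of_ne hac' hza, Equiv.swap_apply_of_ne_of_ne hbc' hzb]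
  have i2 : ({φ a, φ b, z} : Finset α).image (Equiv.swap (φ c) (φ a)) = {φ c, φ b, z} := by
    simp only [image_insert, image_singleton, Equiv.swap_apply_right]
    rw [Equiv.swap_apply_of_ne_of_ne hbc' hab'.symm, Equiv.swap_apply_of_ne_of_ne hzc.symm hza.symm]
  have i3 : ({φ a, φ b, z} : Finset α).image (Equiv.swap (φ c) (φ b)) = {φ a, φ c, z} := by
    simp only [image_insert, image_singleton, Equiv.swap_apply_right]
    rw [Equiv.swap_apply_of_ne_of_ne hac' hab', Equiv.swap_apply_of_ne_of_ne hzc.symm hzb.symm]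
  have i4 : ({φ c, φ b, z} : Finset α).image (Equiv.swap (φ c) (φ b)) = {φ c, φ b, z} := by
    simp only [image_insert, image_singleton, Equiv.swap_apply_right, Equiv.swap_apply_left]
    rw [Equiv.swap_apply_of_ne_of_ne hzc.symm hzb.symm, insert_comm]
  have i5 : ({φ a, φ b, φ c} : Finset α).image (Equiv.swap (φ c) (φ a)) = {φ a, φ b, φ c} := by
    simp only [image_insert, image_singleton, Equiv.swap_apply_right, Equiv.swap_apply_left]
    rw [Equiv.swap_apply_of_ne_of_ne hbc' hab'.symm]
    ext t; simp only [mem_insert, mem_singleton]; tauto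
  have i6 : ({φ a, φ b, φ c} : Finset α).image (Equiv.swap (φ c) (φ b)) = {φ a, φ b, φ c} := by
    simp only [image_insert, image_singleton, Equiv.swap_apply_right, Equiv.swap_apply_left]
    rw [Equiv.swap_apply_of_ne_of_ne hac' hab']
    ext t; simp only [mem_insert, mem_singleton]; tauto
  have step : E (pre φ a b c z q L) g {φ a, φ b, φ c} = (1 - q) * E M g {φ a, φ b, φ c}
      + q / 3 * (E M g {φ b, φ c, z} + E M g {φ a, φ c, z} + E M g {φ a, φ b, z}) := by
    simp only [pre, E, ← hM, i1, i2, i3, i4, i5, i6]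
    rw [insert_comm (φ c) (φ b)]
    ring
  have n0 := npos hn
  have t1 := hL.2 (fun S => g (S.image φ ∪ ∅))
  rw [← E_embed φ hφ ∅ (by simp), ← hM] at t1
  set f : Finset (Fin n) → ℝ := fun S => g (S.image φ ∪ {z}) with hf
  have t2 := hL.2 (fun S => ∑ i ∈ S, f (S.erase i))
  rw [E_erase] at t2
  have er : ∀ (β : Type) [DecidableEq β] (x y w : β), x ≠ y → x ≠ w → y ≠ w →
      ∀ F : Finset β → ℝ, ∑ i ∈ ({x, y, w} : Finset β), F (({x, y, w} : Finset β).erase i)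
        = F {y, w} + F {x, w} + F {x, y} := by
    intro β _ x y w h1 h2 h3 F
    rw [sum_insert (by simp [h1, h2]), sum_insert (by simp [h3]), sum_singleton]
    have e1 : ({x, y, w} : Finset β).erase x = {y, w} := by ext t; simp; grind
    have e2 : ({x, y, w} : Finset β).erase y = {x, w} := by ext t; simp; grind
    have e3 : ({x, y, w} : Finset β).erase w = {x, y} := by ext t; simp; grind
    rw [e1, e2, e3]; ring
  rw [er _ a b c hab hac hbc (E L f)] at t2
  have em : ∀ x y : Fin n, E L f {x, y} = E M g {φ x, φ y, z} := by
    intro x y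
    rw [hf, ← E_embed φ hφ {z} (by simpa using hz), ← hM]
    congr 1
    ext t; simp [or_assoc]
  rw [em, em, em] at t2
  have t3 : T3 (fun S => ∑ i ∈ S, f (S.erase i)) =
      3 * (((n:ℝ) - 2) * ∑ x : Fin n, ∑ y : Fin n, if x ≠ y then g {φ x, φ y, z} else 0) := by
    have fe : ∀ x y : Fin n, f {x, y} = g {φ x, φ y, z} := by
      intro x y
      simp only [hf]
      congr 1
      ext t; simp [or_assoc]
    rw [← sum_third]
    have s1 : T3 (fun S => ∑ i ∈ S, f (S.erase i)) =
      (∑ x : Fin n, ∑ y : Fin n, ∑ w : Fin n, if x ≠ y ∧ x ≠ w ∧ y ≠ w then f {y, w} else 0)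
      + (∑ x : Fin n, ∑ y : Fin n, ∑ w : Fin n, if x ≠ y ∧ x ≠ w ∧ y ≠ w then f {x, w} else 0)
      + (∑ x : Fin n, ∑ y : Fin n, ∑ w : Fin n, if x ≠ y ∧ x ≠ w ∧ y ≠ w then f {x, y} else 0)
      := by
      simp only [T3, ← sum_add_distrib]
      refine sum_congr rfl fun x _ => sum_congr rfl fun y _ => sum_congr rfl fun w _ => ?_
      split_ifs with h
      · exact er _ x y w h.1 h.2.1 h.2.2 f
      · simp
    have s2 : (∑ x : Fin n, ∑ y : Fin n, ∑ w : Fin n,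
        if x ≠ y ∧ x ≠ w ∧ y ≠ w then f {x, w} else 0) = 
        (∑ x : Fin n, ∑ y : Fin n, ∑ w : Fin n, if x ≠ y ∧ x ≠ w ∧ y ≠ w then f {x, y} else 0) := by
      refine sum_congr rfl fun x _ => ?_
      rw [sum_comm]
      refine sum_congr rfl fun y _ => sum_congr rfl fun w _ => ?_
      exact if_congr (by grind) rfl rfl
    have s3 : (∑ x : Fin n, ∑ y : Fin n, ∑ w : Fin n,
        if x ≠ y ∧ x ≠ w ∧ y ≠ w then f {y, w} else 0) = 
        (∑ x : Fin n, ∑ y : Fin n, ∑ w : Fin n, if x ≠ y ∧ x ≠ w ∧ y ≠ w then f {x, w} else 0) := by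
      rw [sum_comm]
      refine sum_congr rfl fun y _ => sum_congr rfl fun x _ => sum_congr rfl fun w _ => ?_
      exact if_congr (by grind) rfl rfl
    rw [s1, s3, s2]
    simp only [fe]
    ring
  rw [t3] at t2
  simp only [Fintype.card_fin, image_insert, image_singleton, union_empty, T3] at t1 t2
  rw [step]
  have h3 : (3:ℝ) ≤ n := by exact_mod_cast hn
  have h1 : (n:ℝ) - 1 ≠ 0 := by intro h; linarith
  have h2 : (n:ℝ) - 2 ≠ 0 := by intro h; linarith
  have h0 : (n:ℝ) ≠ 0 := by intro h; linarith
  rw [← t1]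
  have t2' : E M g {φ b, φ c, z} + E M g {φ a, φ c, z} + E M g {φ a, φ b, z} =
    3 / ((n:ℝ) * (n-1)) * ∑ x : Fin n, ∑ y : Fin n, if x ≠ y then g {φ x, φ y, z} else 0 := by
    field_simp
    apply mul_left_cancel₀ h2
    linarith
  rw [t2']
  field_simp

lemma pre_valid {n : ℕ} {α : Type} (φ : Fin n → α)
    (hφ : Function.Injective φ) (z : α) (hz : ∀ i, φ i ≠ z) (q : ℝ) (hq : 0 ≤ q) (hq1 : q ≤ 1)
    (a b c : Fin n) (hac : a ≠ c) (hbc : b ≠ c) (L : List (LazyT n)) (hL : Sh L a b c) :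
    ∀ e ∈ pre φ a b c z q L, e.1 ≠ e.2.1 ∧ 0 ≤ e.2.2 ∧ e.2.2 ≤ 1 := by
  intro e he
  simp only [pre, List.mem_cons, List.mem_map] at he
  rcases he with rfl | rfl | rfl | ⟨e, he, rfl⟩
  · exact ⟨hz c, hq, hq1⟩
  · exact ⟨hφ.ne hac.symm, by norm_num, by norm_num⟩
  · exact ⟨hφ.ne hbc.symm, by norm_num, by norm_num⟩
  · exact ⟨hφ.ne (hL.1 e he).1, (hL.1 e he).2⟩

lemma exists_sh (m : ℕ) : ∃ L : List (LazyT (m + 3)), Sh L ⟨0, by omega⟩ ⟨1, by omega⟩ ⟨2, by omega⟩ := by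
  induction m with
  | zero =>
    refine ⟨[], by simp, fun g => ?_⟩
    have : (powersetCard 3 (univ : Finset (Fin (0+3)))) = {{⟨0, by omega⟩, ⟨1, by omega⟩, ⟨2, by omega⟩}} := by decide
    rw [T3_eq, this]
    simp [E]; norm_num
  | succ m ih =>
    obtain ⟨L, hL⟩ := ih
    have hz : ∀ i : Fin (m+3), Fin.castSucc i ≠ Fin.last (m+3) := fun i => Fin.castSucc_ne_last i
    refine ⟨pre Fin.castSucc ⟨0, by omega⟩ ⟨1, by omega⟩ ⟨2, by omega⟩ (Fin.last (m+3)) (3 / ((m:ℝ) + 4)) L, ?_, fun g => ?_⟩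
    · refine pre_valid _ (Fin.castSucc_injective _) _ hz _ (by positivity) ?_ _ _ _ ?_ ?_ _ hL
      · rw [div_le_one (by positivity)]
        have : (0:ℝ) ≤ m := by positivity
        linarith
      · simp [Fin.ext_iff]
      · simp [Fin.ext_iff]
    · have := pre_eq (by omega) Fin.castSucc (Fin.castSucc_injective _) _ hz (3 / ((m:ℝ) + 4))
        ⟨0, by omega⟩ ⟨1, by omega⟩ ⟨2, by omega⟩ (by simp [Fin.ext_iff]) (by simp [Fin.ext_iff])
        (by simp [Fin.ext_iff]) L hL g
      have e0 : ({⟨0, by omega⟩, ⟨1, by omega⟩, ⟨2, by omega⟩} : Finset (Fin (m+1+3))) =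
        {Fin.castSucc (⟨0, by omega⟩ : Fin (m+3)), Fin.castSucc ⟨1, by omega⟩, Fin.castSucc ⟨2, by omega⟩} := rfl
      rw [e0, this]
      have r1 : ∀ x y : Fin (m+3), ({x.castSucc, Fin.last (m+3), y.castSucc} : Finset _) =
        {x.castSucc, y.castSucc, Fin.last (m+3)} := by
        intro x y; ext t; simp only [mem_insert, mem_singleton]; tauto
      have r2 : ∀ x y : Fin (m+3), ({Fin.last (m+3), x.castSucc, y.castSucc} : Finset _) =
        {x.castSucc, y.castSucc, Fin.last (m+3)} := by
        intro x y; ext t; simp only [mem_insert, mem_singleton]; tauto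
      have key : T3 g = (∑ x : Fin (m+3), ∑ y : Fin (m+3), ∑ w : Fin (m+3),
            if x ≠ y ∧ x ≠ w ∧ y ≠ w then g {x.castSucc, y.castSucc, w.castSucc} else 0)
          + 3 * (∑ x : Fin (m+3), ∑ y : Fin (m+3),
            if x ≠ y then g {x.castSucc, y.castSucc, Fin.last (m+3)} else 0) := by
        unfold T3
        simp only [Fin.sum_univ_castSucc (n := m+3), sum_add_distrib, ne_eq, Fin.castSucc_inj, hz, (hz _).symm,
          not_true, not_false_iff, and_true, true_and, and_false, false_and, if_false, r1, r2,
          sum_const_zero, add_zero]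
        ring
      rw [key]
      simp only [Fintype.card_fin]
      push_cast
      have p0 : (m:ℝ) + 4 ≠ 0 := by positivity
      have p1 : (m:ℝ) + 3 ≠ 0 := by positivity
      have p2 : (m:ℝ) + 3 - 1 ≠ 0 := by
        have : (0:ℝ) ≤ m := by positivity
        intro h; linarith
      have p3 : (m:ℝ) + 3 - 2 ≠ 0 := by
        have : (0:ℝ) ≤ m := by positivity
        intro h; linarith
      field_simp
      ring

/-- Star sequence spreading the content of `z` over `z` and `l`. -/
noncomputable def star {α : Type} (z : α) : List α → List (α × α × ℝ)
  | [] => []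
  | j :: l => (z, j, 1 / ((l.length : ℝ) + 2)) :: star z l

lemma star_mem {α : Type} (z : α) (l : List α) : ∀ e ∈ star z l,
    e.1 = z ∧ e.2.1 ∈ l ∧ 0 ≤ e.2.2 ∧ e.2.2 ≤ 1 := by
  induction l with
  | nil => simp [star]
  | cons j l ih =>
    intro e he
    simp only [star, List.mem_cons] at he
    rcases he with rfl | he
    · refine ⟨rfl, by simp, by positivity, ?_⟩
      rw [div_le_one (by positivity)]
      have : (0:ℝ) ≤ l.length := by positivity
      linarith
    · have := ih e he
      exact ⟨this.1, by simp [this.2.1], this.2.2⟩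

lemma star_length {α : Type} (z : α) (l : List α) : (star z l).length = l.length := by
  induction l with
  | nil => rfl
  | cons j l ih => simp [star, ih]

lemma star_eq {α : Type} [DecidableEq α] (z : α) (l : List α) (hl : l.Nodup) (hzl : z ∉ l)
    (P : Finset α) (hP : ∀ j ∈ l, j ∉ P) (hz : z ∉ P) (g : Finset α → ℝ) :
    E (star z l) g (insert z P) = 1 / ((l.length : ℝ) + 1) *
      (g (insert z P) + (l.map fun j => g (insert j P)).sum) := by
  induction l with
  | nil => simp [star, E]
  | cons j l ih =>
    have hj : j ∉ P := hP j (by simp)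
    have im : (insert z P).image (Equiv.swap z j) = insert j P := by
      rw [image_insert, Equiv.swap_apply_left]
      congr 1
      conv_rhs => rw [← image_id (s := P)]
      refine image_congr fun x hx => ?_
      rw [Equiv.swap_apply_of_ne_of_ne] <;> first | rfl | (rintro rfl; simp_all)
    simp only [List.mem_cons, not_or] at hzl
    simp only [star, E, im]
    rw [ih (List.nodup_cons.1 hl).2 hzl.2 (fun i hi => hP i (by simp [hi])), E_fix]
    · simp only [List.map_cons, List.sum_cons, List.length_cons]
      push_cast
      have p1 : (l.length : ℝ) + 1 ≠ 0 := by positivity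
      have p2 : (l.length : ℝ) + 2 ≠ 0 := by positivity
      have p3 : (l.length : ℝ) + 1 + 1 ≠ 0 := by positivity
      field_simp
      ring
    · intro e he
      obtain ⟨h1, h2, -⟩ := star_mem z l e he
      rw [h1]
      refine ⟨by simp [hzl.1, hz], ?_⟩
      have : e.2.1 ≠ j := by
        rintro rfl; exact (List.nodup_cons.1 hl).1 h2
      simp [this, hP e.2.1 (by simp [h2])]

/-- Final sequence of pair swaps. -/
noncomputable def fin {k : ℕ} (l : List (Fin k)) :
    List ((Fin k ⊕ Fin k) × (Fin k ⊕ Fin k) × ℝ) :=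
  l.map fun i => (Sum.inl i, Sum.inr i, 1/2)

lemma fin_inv {k : ℕ} (l : List (Fin k)) (g : Finset (Fin k ⊕ Fin k) → ℝ) (i : Fin k)
    (hi : i ∈ l) (S : Finset (Fin k ⊕ Fin k)) :
    E (fin l) g (S.image (Equiv.swap (Sum.inl i) (Sum.inr i))) = E (fin l) g S := by
  induction l generalizing S with
  | nil => simp at hi
  | cons j l ih =>
    simp only [fin, List.map_cons, E]
    change 1/2 * E (fin l) g _ + (1 - 1/2) * E (fin l) g _ =
      1/2 * E (fin l) g _ + (1 - 1/2) * E (fin l) g _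
    by_cases hij : i = j
    · subst hij
      have : (S.image (Equiv.swap (Sum.inl i) (Sum.inr i))).image
          (Equiv.swap (Sum.inl i) (Sum.inr i)) = S := by
        rw [image_image, ← Equiv.coe_trans]
        simp
      rw [this]; ring
    · have hil : i ∈ l := by simpa [hij] using hi
      have : (S.image (Equiv.swap (Sum.inl i) (Sum.inr i))).image
          (Equiv.swap (Sum.inl j) (Sum.inr j)) = (S.image (Equiv.swap (Sum.inl j) (Sum.inr j))).image
          (Equiv.swap (Sum.inl i) (Sum.inr i)) := by
        rw [image_image, image_image]
        refine image_congr fun x _ => ?_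
        simp only [Function.comp, Equiv.swap_apply_def]
        grind
      rw [this, ih hil, ih hil]

lemma pair_sum {k : ℕ} (h : Finset (Fin k ⊕ Fin k) → ℝ)
    (hh : ∀ i S, h (S.image (Equiv.swap (Sum.inl i) (Sum.inr i))) = h S) :
    ∃ T D : ℝ,
      T = (∑ x : Fin k, ∑ y : Fin k, ∑ w : Fin k,
            if x ≠ y ∧ x ≠ w ∧ y ≠ w then h {Sum.inl x, Sum.inl y, Sum.inl w} else 0) ∧
      T3 h = 8 * T + 12 * D ∧
      (∑ x : Fin k, ∑ y : Fin k, if x ≠ y then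
        ∑ j : Fin k, h {Sum.inl x, Sum.inl y, Sum.inr j} else 0) = T + 2 * D := by
  set H : Fin k ⊕ Fin k → Fin k ⊕ Fin k → Fin k ⊕ Fin k → ℝ := fun x y w => h {x, y, w} with hH
  have c1 : ∀ x y w, H x y w = H y x w := fun x y w => by simp only [hH, insert_comm x y]
  have c2 : ∀ x y w, H x y w = H x w y := fun x y w => by
    simp only [hH]; rw [pair_comm]
  have c3 : ∀ a y w, y ≠ Sum.inl a → y ≠ Sum.inr a → w ≠ Sum.inl a → w ≠ Sum.inr a →
      H (Sum.inr a) y w = H (Sum.inl a) y w := by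
    intro a y w h1 h2 h3 h4
    have := hh a {Sum.inl a, y, w}
    simp only [image_insert, image_singleton, Equiv.swap_apply_left,
      Equiv.swap_apply_of_ne_of_ne h1 h2, Equiv.swap_apply_of_ne_of_ne h3 h4] at this
    exact this
  set D : Fin k → Fin k → ℝ := fun a c => H (Sum.inl a) (Sum.inr a) (Sum.inl c) with hD
  have c4 : ∀ a b c : Fin k, a ≠ b → a ≠ c → H (Sum.inr a) (Sum.inl b) (Sum.inl c)
      = H (Sum.inl a) (Sum.inl b) (Sum.inl c) := fun a b c h1 h2 =>
    c3 _ _ _ (by simp [h1.symm]) (by simp) (by simp [h2.symm]) (by simp)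
  have c5 : ∀ a b c : Fin k, a ≠ b → a ≠ c → H (Sum.inr a) (Sum.inr b) (Sum.inl c)
      = H (Sum.inl a) (Sum.inr b) (Sum.inl c) := fun a b c h1 h2 =>
    c3 _ _ _ (by simp) (by simp [h1.symm]) (by simp [h2.symm]) (by simp)
  have c6 : ∀ a b c : Fin k, a ≠ b → a ≠ c → H (Sum.inr a) (Sum.inr b) (Sum.inr c)
      = H (Sum.inl a) (Sum.inr b) (Sum.inr c) := fun a b c h1 h2 =>
    c3 _ _ _ (by simp) (by simp [h1.symm]) (by simp) (by simp [h2.symm])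
  have c7 : ∀ a b c : Fin k, a ≠ b → a ≠ c → H (Sum.inr a) (Sum.inl b) (Sum.inr c)
      = H (Sum.inl a) (Sum.inl b) (Sum.inr c) := fun a b c h1 h2 =>
    c3 _ _ _ (by simp [h1.symm]) (by simp) (by simp) (by simp [h2.symm])
  have d2 : ∀ a c : Fin k, a ≠ c → H (Sum.inl a) (Sum.inr a) (Sum.inr c) = D a c := by
    intro a c hac
    rw [c2, c1, c3 _ _ _ (by simp [hac]) (by simp) (by simp) (by simp [hac]), c1, c2]
  have g1 : ∀ a b c : Fin k, a ≠ b → a ≠ c → b ≠ c → H (Sum.inl a) (Sum.inl b) (Sum.inr c)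
      = H (Sum.inl a) (Sum.inl b) (Sum.inl c) := by
    intro a b c h1 h2 h3
    rw [c2, c1, c4 _ _ _ h2.symm h3.symm, c1, c2]
  have g2 : ∀ a b c : Fin k, a ≠ b → a ≠ c → b ≠ c → H (Sum.inl a) (Sum.inr b) (Sum.inl c)
      = H (Sum.inl a) (Sum.inl b) (Sum.inl c) := by
    intro a b c h1 h2 h3
    rw [c1, c4 _ _ _ h1.symm h3, c1]
  have g3 : ∀ a b c : Fin k, a ≠ b → a ≠ c → b ≠ c → H (Sum.inl a) (Sum.inr b) (Sum.inr c)
      = H (Sum.inl a) (Sum.inl b) (Sum.inl c) := by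
    intro a b c h1 h2 h3
    rw [c1, c7 _ _ _ h1.symm h3, c1, g1 _ _ _ h1 h2 h3]
  have P2 : ∀ a b c : Fin k,
      (if a ≠ b then H (Sum.inl a) (Sum.inl b) (Sum.inr c) else 0) =
      (if a ≠ b ∧ a ≠ c ∧ b ≠ c then H (Sum.inl a) (Sum.inl b) (Sum.inl c) else 0)
      + (if a = c then (if a ≠ b then D a b else 0) else 0)
      + (if b = c then (if b ≠ a then D b a else 0) else 0) := by
    intro a b c
    by_cases hab : a = b
    · simp [hab]
    · by_cases hac : a = c
      · subst hac
        simp [hab, Ne.symm hab, hD, c2 (Sum.inl a) (Sum.inl b)]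
      · by_cases hbc : b = c
        · subst hbc
          simp [hab, Ne.symm hab, hD]
          rw [c1, c2]
        · simp [hab, hac, hbc, g1 a b c hab hac hbc]
  have P3 : ∀ a b c : Fin k,
      (if (Sum.inl a : Fin k ⊕ Fin k) ≠ Sum.inl b ∧ (Sum.inl a : Fin k ⊕ Fin k) ≠ Sum.inl c
        ∧ (Sum.inl b : Fin k ⊕ Fin k) ≠ Sum.inl c then H (Sum.inl a) (Sum.inl b) (Sum.inl c) else 0)
      + (if (Sum.inl a : Fin k ⊕ Fin k) ≠ Sum.inl b ∧ (Sum.inl a : Fin k ⊕ Fin k) ≠ Sum.inr c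
        ∧ (Sum.inl b : Fin k ⊕ Fin k) ≠ Sum.inr c then H (Sum.inl a) (Sum.inl b) (Sum.inr c) else 0)
      + ((if (Sum.inl a : Fin k ⊕ Fin k) ≠ Sum.inr b ∧ (Sum.inl a : Fin k ⊕ Fin k) ≠ Sum.inl c
        ∧ (Sum.inr b : Fin k ⊕ Fin k) ≠ Sum.inl c then H (Sum.inl a) (Sum.inr b) (Sum.inl c) else 0)
      + (if (Sum.inl a : Fin k ⊕ Fin k) ≠ Sum.inr b ∧ (Sum.inl a : Fin k ⊕ Fin k) ≠ Sum.inr c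
        ∧ (Sum.inr b : Fin k ⊕ Fin k) ≠ Sum.inr c then H (Sum.inl a) (Sum.inr b) (Sum.inr c) else 0))
      + ((if (Sum.inr a : Fin k ⊕ Fin k) ≠ Sum.inl b ∧ (Sum.inr a : Fin k ⊕ Fin k) ≠ Sum.inl c
        ∧ (Sum.inl b : Fin k ⊕ Fin k) ≠ Sum.inl c then H (Sum.inr a) (Sum.inl b) (Sum.inl c) else 0)
      + (if (Sum.inr a : Fin k ⊕ Fin k) ≠ Sum.inl b ∧ (Sum.inr a : Fin k ⊕ Fin k) ≠ Sum.inr c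
        ∧ (Sum.inl b : Fin k ⊕ Fin k) ≠ Sum.inr c then H (Sum.inr a) (Sum.inl b) (Sum.inr c) else 0)
      + ((if (Sum.inr a : Fin k ⊕ Fin k) ≠ Sum.inr b ∧ (Sum.inr a : Fin k ⊕ Fin k) ≠ Sum.inl c
        ∧ (Sum.inr b : Fin k ⊕ Fin k) ≠ Sum.inl c then H (Sum.inr a) (Sum.inr b) (Sum.inl c) else 0)
      + (if (Sum.inr a : Fin k ⊕ Fin k) ≠ Sum.inr b ∧ (Sum.inr a : Fin k ⊕ Fin k) ≠ Sum.inr c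
        ∧ (Sum.inr b : Fin k ⊕ Fin k) ≠ Sum.inr c then H (Sum.inr a) (Sum.inr b) (Sum.inr c) else 0)))
      = 8 * (if a ≠ b ∧ a ≠ c ∧ b ≠ c then H (Sum.inl a) (Sum.inl b) (Sum.inl c) else 0)
      + 4 * (if a = b then (if a ≠ c then D a c else 0) else 0)
      + 4 * (if a = c then (if a ≠ b then D a b else 0) else 0)
      + 4 * (if b = c then (if b ≠ a then D b a else 0) else 0) := by
    intro a b c
    by_cases hab : a = b
    · subst hab
      by_cases hac : a = c
      · subst hac; simp
      · simp [hac]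
        rw [d2 a c hac, c1 (Sum.inr a), c1 (Sum.inr a), d2 a c hac]
        simp only [hD]; ring
    · by_cases hac : a = c
      · subst hac
        simp [hab, Ne.symm hab]
        have q1 : ∀ w, H (Sum.inl a) w (Sum.inr a) = H (Sum.inl a) (Sum.inr a) w := fun w => c2 _ _ _
        have q2 : ∀ w, H (Sum.inr a) w (Sum.inl a) = H (Sum.inl a) (Sum.inr a) w := fun w => by
          rw [c2, c1]
        rw [q1, q1, q2, q2, d2 a b hab]
        simp only [hD]; ring
      · by_cases hbc : b = c
        · subst hbc
          simp [hab, Ne.symm hab]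
          have q1 : ∀ w, H w (Sum.inl b) (Sum.inr b) = H (Sum.inl b) (Sum.inr b) w := fun w => by
            rw [c1, c2]
          have q2 : ∀ w, H w (Sum.inr b) (Sum.inl b) = H (Sum.inl b) (Sum.inr b) w := fun w => by
            rw [c2, q1]
          rw [q1, q1, q2, q2, d2 b a (Ne.symm hab)]
          simp only [hD]; ring
        · simp [hab, hac, hbc, g1 a b c hab hac hbc, g2 a b c hab hac hbc, g3 a b c hab hac hbc,
            c4 a b c hab hac, c5 a b c hab hac, c6 a b c hab hac, c7 a b c hab hac]
          ring
  have S1 : (∑ a : Fin k, ∑ b : Fin k, ∑ c : Fin k, if a = b then (if a ≠ c then D a c else 0)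
      else 0) = ∑ a : Fin k, ∑ c : Fin k, if a ≠ c then D a c else 0 := by
    refine sum_congr rfl fun a _ => ?_
    rw [sum_comm]
    simp
  have S2 : (∑ a : Fin k, ∑ b : Fin k, ∑ c : Fin k, if a = c then (if a ≠ b then D a b else 0)
      else 0) = ∑ a : Fin k, ∑ c : Fin k, if a ≠ c then D a c else 0 := by
    simp
  have S3 : (∑ a : Fin k, ∑ b : Fin k, ∑ c : Fin k, if b = c then (if b ≠ a then D b a else 0)
      else 0) = ∑ a : Fin k, ∑ c : Fin k, if a ≠ c then D a c else 0 := by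
    rw [sum_comm]
    simp
  refine ⟨_, ∑ a : Fin k, ∑ c : Fin k, if a ≠ c then D a c else 0, rfl, ?_, ?_⟩
  · have e1 : T3 h = ∑ a : Fin k, ∑ b : Fin k, ∑ c : Fin k,
        (8 * (if a ≠ b ∧ a ≠ c ∧ b ≠ c then H (Sum.inl a) (Sum.inl b) (Sum.inl c) else 0)
      + 4 * (if a = b then (if a ≠ c then D a c else 0) else 0)
      + 4 * (if a = c then (if a ≠ b then D a b else 0) else 0)
      + 4 * (if b = c then (if b ≠ a then D b a else 0) else 0)) := by
      simp only [T3, Fintype.sum_sum_type, ← sum_add_distrib]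
      exact sum_congr rfl fun a _ => sum_congr rfl fun b _ => sum_congr rfl fun c _ => P3 a b c
    rw [e1]
    simp only [sum_add_distrib, ← mul_sum, S1, S2, S3]
    ring
  · have e1 : (∑ x : Fin k, ∑ y : Fin k, if x ≠ y then
        ∑ j : Fin k, h {Sum.inl x, Sum.inl y, Sum.inr j} else 0) =
        ∑ a : Fin k, ∑ b : Fin k, ∑ c : Fin k,
      ((if a ≠ b ∧ a ≠ c ∧ b ≠ c then H (Sum.inl a) (Sum.inl b) (Sum.inl c) else 0)
      + (if a = c then (if a ≠ b then D a b else 0) else 0)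
      + (if b = c then (if b ≠ a then D b a else 0) else 0)) := by
      refine sum_congr rfl fun a _ => sum_congr rfl fun b _ => ?_
      simp only [← P2]
      split_ifs <;> simp [hH]
    rw [e1]
    simp only [sum_add_distrib, S2, S3]
    ring

lemma arith (k T D : ℝ) (p0 : k ≠ 0) (p1 : k - 1 ≠ 0) (p2 : k - 2 ≠ 0) (p3 : 2 * k - 1 ≠ 0) :
    (k + k) * (k + k - 1) * (k + k - 2) *
      ((1 - 3 * k / (2 * (2 * k - 1))) / (k * (k - 1) * (k - 2)) * T +
        3 * k / (2 * (2 * k - 1)) / (k * (k - 1)) * (1 / k * (T + 2 * D))) = 8 * T + 12 * D := by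
  have e1 : 1 - 3 * k / (2 * (2 * k - 1)) = (k - 2) / (2 * (2 * k - 1)) := by
    rw [eq_div_iff (by positivity), sub_mul, div_mul_cancel₀ _ (by positivity)]
    ring
  have e2 : (k + k) * (k + k - 1) * (k + k - 2) = 4 * k * (k - 1) * (2 * k - 1) := by ring
  rw [e1, e2]
  generalize 2 * k - 1 = u at *
  field_simp
  ring

lemma double_sh {k : ℕ} (hk : 3 ≤ k) (L : List (LazyT k))
    (hL : Sh L ⟨0, by omega⟩ ⟨1, by omega⟩ ⟨2, by omega⟩) :
    ∃ M : List ((Fin k ⊕ Fin k) × (Fin k ⊕ Fin k) × ℝ), M.length = 2 * k + 2 + L.length ∧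
      Sh M (Sum.inl ⟨0, by omega⟩) (Sum.inl ⟨1, by omega⟩) (Sum.inl ⟨2, by omega⟩) := by
  have hk3 : (3:ℝ) ≤ k := by exact_mod_cast hk
  set z0 : Fin k := ⟨0, by omega⟩ with hz0
  set l : List (Fin k ⊕ Fin k) := ((univ.erase z0).toList).map Sum.inr with hl
  have hlen : l.length = k - 1 := by simp [hl]
  have hnd : l.Nodup := (nodup_toList _).map Sum.inr_injective
  have hzl : (Sum.inr z0 : Fin k ⊕ Fin k) ∉ l := by simp [hl]
  have hlr : ∀ j ∈ l, ∃ i, j = Sum.inr i := by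
    intro j hj
    obtain ⟨i, -, rfl⟩ := List.mem_map.1 hj
    exact ⟨i, rfl⟩
  set q : ℝ := 3 * k / (2 * (2 * k - 1)) with hq
  have hd : (0:ℝ) < 2 * (2 * k - 1) := by linarith
  refine ⟨pre Sum.inl z0 ⟨1, by omega⟩ ⟨2, by omega⟩ (Sum.inr z0) q L ++ (star (Sum.inr z0) l ++
    fin (List.finRange k)), ?_, ?_, ?_⟩
  · simp [pre, star_length, hlen, fin]
    omega
  · intro e he
    simp only [List.mem_append] at he
    rcases he with he | he | he
    · refine pre_valid Sum.inl Sum.inl_injective _ (by simp) q (by positivity) ?_ _ _ _ ?_ ?_ L hL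
        e he
      · rw [hq, div_le_one hd]; linarith
      · simp [hz0]
      · simp
    · obtain ⟨h1, h2, h3⟩ := star_mem _ _ e he
      refine ⟨?_, h3⟩
      rw [h1]
      rintro h
      exact hzl (h ▸ h2)
    · obtain ⟨i, -, rfl⟩ := List.mem_map.1 he
      exact ⟨by simp, by norm_num, by norm_num⟩
  · intro g
    rw [E_append, pre_eq hk Sum.inl Sum.inl_injective _ (by simp) q _ _ _ (by simp [hz0])
      (by simp [hz0]) (by simp) L hL]
    set h := E (fin (List.finRange k)) g with hh
    rw [← T3_E (fin (List.finRange k)) g, ← hh]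
    obtain ⟨T, D, hT, h1, h2⟩ := pair_sum h (fun i S => fin_inv _ g i (by simp) S)
    have s1 : ∀ x y w : Fin k, E (star (Sum.inr z0) l ++ fin (List.finRange k)) g
        {Sum.inl x, Sum.inl y, Sum.inl w} = h {Sum.inl x, Sum.inl y, Sum.inl w} := by
      intro x y w
      rw [E_append, E_fix]
      intro e he
      obtain ⟨h1, h2, -⟩ := star_mem _ _ e he
      obtain ⟨i, hi⟩ := hlr _ h2
      rw [h1, hi]
      simp
    have s2 : ∀ x y : Fin k, E (star (Sum.inr z0) l ++ fin (List.finRange k)) g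
        {Sum.inl x, Sum.inl y, Sum.inr z0} =
        1 / (k:ℝ) * ∑ j : Fin k, h {Sum.inl x, Sum.inl y, Sum.inr j} := by
      intro x y
      have r : ∀ j : Fin k, ({Sum.inl x, Sum.inl y, Sum.inr j} : Finset (Fin k ⊕ Fin k)) =
          insert (Sum.inr j) {Sum.inl x, Sum.inl y} := by
        intro j; ext t; simp only [mem_insert, mem_singleton]; tauto
      simp only [r]
      rw [E_append, star_eq _ _ hnd hzl, hlen]
      · have : ((k - 1 : ℕ) : ℝ) + 1 = k := by
          rw [Nat.cast_sub (by omega)]; simp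
        rw [this, ← hh]
        congr 1
        rw [← add_sum_erase univ _ (mem_univ z0), ← sum_map_toList, hl, List.map_map]
        rfl
      · intro j hj
        obtain ⟨i, rfl⟩ := hlr _ hj
        simp
      · simp
    simp only [s1, s2]
    have s3 : (∑ x : Fin k, ∑ y : Fin k, if x ≠ y then
        1 / (k:ℝ) * ∑ j : Fin k, h {Sum.inl x, Sum.inl y, Sum.inr j} else 0)
        = 1 / (k:ℝ) * (T + 2 * D) := by
      rw [← h2]
      simp only [mul_sum (s := (univ : Finset (Fin k)))]
      refine sum_congr rfl fun x _ => ?_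
      refine sum_congr rfl fun y _ => ?_
      split_ifs <;> simp [mul_sum]
    rw [s3, ← hT, h1, hq]
    simp only [Fintype.card_sum, Fintype.card_fin]
    push_cast
    have p0 : (k:ℝ) ≠ 0 := by intro h; linarith
    have p1 : (k:ℝ) - 1 ≠ 0 := by intro h; linarith
    have p2 : (k:ℝ) - 2 ≠ 0 := by intro h; linarith
    have p3 : 2 * (k:ℝ) - 1 ≠ 0 := by intro h; linarith
    exact arith k T D p0 p1 p2 p3

lemma transport {k : ℕ} (hk : 3 ≤ k) (M : List ((Fin k ⊕ Fin k) × (Fin k ⊕ Fin k) × ℝ))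
    (hM : Sh M (Sum.inl ⟨0, by omega⟩) (Sum.inl ⟨1, by omega⟩) (Sum.inl ⟨2, by omega⟩)) :
    ∃ N : List (LazyT (2 * k)), N.length = M.length ∧
      Sh N ⟨0, by omega⟩ ⟨1, by omega⟩ ⟨2, by omega⟩ := by
  let φ : Fin k ⊕ Fin k ≃ Fin (2 * k) := finSumFinEquiv.trans (finCongr (two_mul k).symm)
  refine ⟨M.map fun e => (φ e.1, φ e.2.1, e.2.2), by simp, ?_, fun g => ?_⟩
  · intro e he
    obtain ⟨e, he', rfl⟩ := List.mem_map.1 he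
    exact ⟨φ.injective.ne (hM.1 e he').1, (hM.1 e he').2⟩
  · have := E_embed φ φ.injective ∅ (by simp) M g
      {Sum.inl ⟨0, by omega⟩, Sum.inl ⟨1, by omega⟩, Sum.inl ⟨2, by omega⟩}
    have hs : image φ {Sum.inl ⟨0, by omega⟩, Sum.inl ⟨1, by omega⟩, Sum.inl ⟨2, by omega⟩} ∪ ∅ =
      {⟨0, by omega⟩, ⟨1, by omega⟩, ⟨2, by omega⟩} := by
      simp only [image_insert, image_singleton, union_empty]
      rfl
    rw [hs] at this
    rw [this, ← Fintype.card_congr φ, hM.2]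
    unfold T3
    rw [← Equiv.sum_comp φ]
    refine sum_congr rfl fun x _ => ?_
    rw [← Equiv.sum_comp φ]
    refine sum_congr rfl fun y _ => ?_
    rw [← Equiv.sum_comp φ]
    refine sum_congr rfl fun w _ => ?_
    simp only [ne_eq, EmbeddingLike.apply_eq_iff_eq, image_insert, image_singleton, union_empty]

end UhatThree

open UhatThree
theorem Uhat_three_doubling (k : ℕ) (hk : 3 ≤ k) :
    Uhat 3 (2 * k) ≤ 2 * k + 2 + Uhat 3 k := by
  have hne : { ℓ : ℕ | ∃ (ht : 3 ≤ k) (L : List (LazyT k)),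
      L.length = ℓ ∧ IsIndShuffle ht L }.Nonempty := by
    obtain ⟨m, rfl⟩ := Nat.exists_eq_add_of_le' hk
    obtain ⟨L, hL⟩ := exists_sh m
    exact ⟨L.length, hk, L, rfl, (sh_iff hk L).2 hL⟩
  obtain ⟨ht, L, hlen, hL⟩ := Nat.sInf_mem hne
  obtain ⟨M, hMl, hM⟩ := double_sh hk L ((sh_iff hk L).1 hL)
  obtain ⟨N, hNl, hN⟩ := transport hk M hM
  refine Nat.sInf_le ⟨by omega, N, ?_, (sh_iff (by omega) N).2 hN⟩
  rw [hNl, hMl, hlen]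
  rfl
end

section
/- For every integer k ≥ 4, Û_4(2k) ≤ 3k + 4 + Û_4(k). -/
open scoped BigOperators

open Finset Equiv

set_option linter.unusedSectionVars false

namespace Dbl

variable {α β : Type*} [DecidableEq α] [DecidableEq β]

/-- Expectation of `F` under the composition of the lazy transpositions in a list. -/
noncomputable def E {α : Type*} [DecidableEq α] : List (α × α × ℝ) → (Perm α → ℝ) → ℝ
  | [], F => F 1
  | e :: L, F => e.2.2 * E L (fun τ => F (τ * swap e.1 e.2.1)) + (1 - e.2.2) * E L F

/-- Image of a set under a permutation. -/
def act {α : Type*} (σ : Perm α) (S : Finset α) : Finset α := S.map σ.toEmbedding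

theorem mem_act (σ : Perm α) (S : Finset α) (x : α) : x ∈ act σ S ↔ σ.symm x ∈ S := by
  simp [act, Finset.mem_map_equiv]

theorem act_mul (σ τ : Perm α) (S : Finset α) : act (σ * τ) S = act σ (act τ S) := by
  ext x; simp only [mem_act]; rfl

theorem act_one (S : Finset α) : act 1 S = S := by
  ext x; simp only [mem_act]; rfl

theorem card_act (σ : Perm α) (S : Finset α) : (act σ S).card = S.card := by simp [act]

theorem act_insert (σ : Perm α) (a : α) (S : Finset α) :
    act σ (insert a S) = insert (σ a) (act σ S) := by simp [act, Finset.map_insert]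

theorem sum_powersetCard_act (σ : Perm α) (D : Finset α) (t : ℕ) (g : Finset α → ℝ) :
    ∑ T ∈ powersetCard t D, g (act σ T) = ∑ T ∈ powersetCard t (act σ D), g T := by
  rw [act, powersetCard_map, Finset.sum_map]; rfl

theorem E_add (L : List (α × α × ℝ)) (F G : Perm α → ℝ) :
    E L (fun σ => F σ + G σ) = E L F + E L G := by
  induction L generalizing F G with
  | nil => rfl
  | cons e L ih => simp only [E, ih]; ring

theorem E_mul (L : List (α × α × ℝ)) (c : ℝ) (F : Perm α → ℝ) :
    E L (fun σ => c * F σ) = c * E L F := by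
  induction L generalizing F with
  | nil => rfl
  | cons e L ih => simp only [E, ih]; ring

theorem E_const (L : List (α × α × ℝ)) (c : ℝ) : E L (fun _ => c) = c := by
  induction L with
  | nil => rfl
  | cons e L ih => simp only [E, ih]; ring

theorem E_sum {ι : Type*} (L : List (α × α × ℝ)) (s : Finset ι) (F : ι → Perm α → ℝ) :
    E L (fun σ => ∑ i ∈ s, F i σ) = ∑ i ∈ s, E L (F i) := by
  classical
  induction s using Finset.induction_on with
  | empty => simp [E_const]
  | insert a s ha ih => simp only [Finset.sum_insert ha, E_add, ih]

theorem E_div (L : List (α × α × ℝ)) (c : ℝ) (F : Perm α → ℝ) :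
    E L (fun σ => F σ / c) = E L F / c := by
  simp only [div_eq_inv_mul, E_mul]

theorem E_append (L M : List (α × α × ℝ)) (F : Perm α → ℝ) :
    E (L ++ M) F = E L (fun σ => E M (fun π => F (π * σ))) := by
  induction L generalizing F with
  | nil => simp [E]
  | cons e L ih => simp only [List.cons_append, E, ih, mul_assoc]

theorem E_comm (L : List (α × α × ℝ)) (M : List (β × β × ℝ)) (K : Perm α → Perm β → ℝ) :
    E L (fun σ => E M (fun π => K σ π)) = E M (fun π => E L (fun σ => K σ π)) := by
  induction L generalizing K with
  | nil => rfl
  | cons e L ih => simp only [E, ih, E_add, E_mul]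

/-- The list of transpositions is supported on the set `D`. -/
def InD (L : List (α × α × ℝ)) (D : Finset α) : Prop := ∀ e ∈ L, e.1 ∈ D ∧ e.2.1 ∈ D

theorem E_congr {L : List (α × α × ℝ)} {D : Finset α} (hL : InD L D) {F G : Perm α → ℝ}
    (h : ∀ σ : Perm α, (∀ x, x ∉ D → σ x = x) → F σ = G σ) : E L F = E L G := by
  induction L generalizing F G with
  | nil => exact h 1 (fun _ _ => rfl)
  | cons e L ih =>
    have hL' : InD L D := fun e' he' => hL e' (List.mem_cons_of_mem _ he')
    have he := hL e List.mem_cons_self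
    simp only [E]
    rw [ih hL' h, ih hL' (F := fun τ => F (τ * swap e.1 e.2.1))
      (G := fun τ => G (τ * swap e.1 e.2.1))]
    intro σ hσ
    apply h
    intro x hx
    have h1 : x ≠ e.1 := fun h => hx (h ▸ he.1)
    have h2 : x ≠ e.2.1 := fun h => hx (h ▸ he.2)
    rw [Perm.mul_apply, swap_apply_of_ne_of_ne h1 h2, hσ x hx]

theorem E_map (f : α → β) (φ : Perm α → Perm β) (h1 : φ 1 = 1)
    (hm : ∀ σ τ, φ (σ * τ) = φ σ * φ τ) (hs : ∀ a b, φ (swap a b) = swap (f a) (f b))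
    (L : List (α × α × ℝ)) (F : Perm β → ℝ) :
    E (L.map (fun e => (f e.1, f e.2.1, e.2.2))) F = E L (fun σ => F (φ σ)) := by
  induction L generalizing F with
  | nil => simp [E, h1]
  | cons e L ih => simp only [List.map_cons, E, ih, hm, hs]

/-- Average over `t`-subsets of `D`. -/
noncomputable def avg (D : Finset α) (t : ℕ) (g : Finset α → ℝ) : ℝ :=
  (∑ T ∈ powersetCard t D, g T) / (D.card.choose t : ℝ)

/-- The list moves `S` to a uniform subset of `D`. -/
def Unif (D : Finset α) (L : List (α × α × ℝ)) (S : Finset α) : Prop :=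
  ∀ g : Finset α → ℝ, E L (fun σ => g (act σ S)) = avg D S.card g

theorem fix_apply {D : Finset α} {σ : Perm α} (h : ∀ x, x ∉ D → σ x = x) (x : α) (hx : x ∈ D) :
    σ x ∈ D := by
  by_contra hc
  have := h _ hc
  exact hc ((σ.injective this).symm ▸ hx)

theorem fix_act {D : Finset α} {σ : Perm α} (h : ∀ x, x ∉ D → σ x = x) : act σ D = D := by
  apply Finset.eq_of_subset_of_card_le
  · intro x hx
    simp only [act, Finset.mem_map] at hx
    obtain ⟨y, hy, rfl⟩ := hx
    exact fix_apply h y hy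
  · rw [card_act]

/-- The star chain at `a`. -/
noncomputable def chain {α : Type*} (a : α) : List α → List (α × α × ℝ)
  | [] => []
  | x :: l => (a, x, 1 / ((l.length : ℝ) + 2)) :: chain a l

theorem chain_length (a : α) (l : List α) : (chain a l).length = l.length := by
  induction l with
  | nil => rfl
  | cons x l ih => simp [chain, ih]

theorem chain_inD (a : α) (l : List α) : InD (chain a l) (insert a l.toFinset) := by
  induction l with
  | nil => intro e he; simp [chain] at he
  | cons x l ih =>
    intro e he
    simp only [chain, List.mem_cons] at he
    rcases he with rfl | he
    · simp
    · have := ih e he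
      simp only [List.toFinset_cons, Finset.mem_insert] at this ⊢
      tauto

theorem chain_valid (a : α) (l : List α) (ha : a ∉ l) :
    ∀ e ∈ chain a l, e.1 ≠ e.2.1 ∧ 0 ≤ e.2.2 ∧ e.2.2 ≤ 1 := by
  induction l with
  | nil => intro e he; simp [chain] at he
  | cons x l ih =>
    intro e he
    simp only [List.mem_cons, not_or] at ha
    simp only [chain, List.mem_cons] at he
    rcases he with rfl | he
    · refine ⟨ha.1, by positivity, ?_⟩
      rw [div_le_one (by positivity)]
      have : (0 : ℝ) ≤ l.length := by positivity
      linarith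
    · exact ih ha.2 e he

theorem chain_unif (a : α) (l : List α) (hl : (a :: l).Nodup) (H : α → ℝ) :
    E (chain a l) (fun π => H (π a)) =
      (∑ x ∈ insert a l.toFinset, H x) / ((l.length : ℝ) + 1) := by
  induction l with
  | nil => simp [chain, E]
  | cons x l ih =>
    simp only [List.nodup_cons, List.mem_cons, not_or] at hl ih
    obtain ⟨⟨hax, hal⟩, hxl, hl⟩ := hl
    have ih := ih ⟨hal, hl⟩
    simp only [chain, E, Perm.mul_apply, swap_apply_left, ih]
    rw [E_congr (chain_inD a l) (F := fun τ => H (τ x)) (G := fun _ => H x), E_const]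
    · rw [Finset.sum_insert (by simpa using hal), List.toFinset_cons, Finset.sum_insert,
        Finset.sum_insert (by simpa using hxl)]
      · simp only [List.length_cons]
        push_cast
        have h1 : (l.length : ℝ) + 1 ≠ 0 := by positivity
        have h2 : (l.length : ℝ) + 2 ≠ 0 := by positivity
        have h3 : (l.length : ℝ) + 1 + 1 ≠ 0 := by positivity
        field_simp
        ring
      · simp [hax, hal]
    · intro σ hσ
      rw [hσ x]
      simp [Ne.symm hax, hxl]

theorem dc1 (X : Finset α) (t : ℕ) (ht : t ≤ X.card) (g : Finset α → ℝ) :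
    ∑ x ∈ X, ∑ T ∈ powersetCard t (X.erase x), g T =
      ((X.card : ℝ) - t) * ∑ T ∈ powersetCard t X, g T := by
  rw [Finset.sum_comm' (t' := powersetCard t X) (s' := fun T => X \ T)]
  · rw [Finset.mul_sum]
    apply Finset.sum_congr rfl
    intro T hT
    rw [mem_powersetCard] at hT
    rw [Finset.sum_const, card_sdiff_of_subset hT.1, hT.2, nsmul_eq_mul, Nat.cast_sub ht]
  · intro x T
    simp only [mem_powersetCard, mem_sdiff, subset_erase]
    tauto

theorem dc2 (X : Finset α) (t : ℕ) (g : Finset α → ℝ) :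
    ∑ x ∈ X, ∑ T ∈ powersetCard t (X.erase x), g (insert x T) =
      ((t : ℝ) + 1) * ∑ T ∈ powersetCard (t + 1) X, g T := by
  have h : ∀ x ∈ X, ∑ T ∈ powersetCard t (X.erase x), g (insert x T) =
      ∑ T ∈ (powersetCard (t + 1) X).filter (x ∈ ·), g T := by
    intro x hx
    apply Finset.sum_nbij' (fun T => insert x T) (fun T => T.erase x)
    · intro T hT
      simp only [mem_powersetCard, subset_erase] at hT
      simp only [mem_filter, mem_powersetCard, mem_insert_self, and_true]
      exact ⟨insert_subset hx hT.1.1, by rw [card_insert_of_notMem hT.1.2, hT.2]⟩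
    · intro T hT
      simp only [mem_filter, mem_powersetCard] at hT
      simp only [mem_powersetCard]
      exact ⟨erase_subset_erase _ hT.1.1, by rw [card_erase_of_mem hT.2, hT.1.2]; simp⟩
    · intro T hT
      simp only [mem_powersetCard, subset_erase] at hT
      exact erase_insert hT.1.2
    · intro T hT
      simp only [mem_filter, mem_powersetCard] at hT
      exact insert_erase hT.2
    · intros; rfl
  rw [Finset.sum_congr rfl h, Finset.sum_comm' (t' := powersetCard (t + 1) X) (s' := fun T => T)]
  · rw [Finset.mul_sum]
    apply Finset.sum_congr rfl
    intro T hT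
    rw [mem_powersetCard] at hT
    rw [Finset.sum_const, hT.2, nsmul_eq_mul]
    push_cast
    rfl
  · intro x T
    simp only [mem_powersetCard, mem_filter]
    constructor
    · tauto
    · rintro ⟨h1, h2, h3⟩
      exact ⟨h2 h1, ⟨h2, h3⟩, h1⟩

theorem dc3 (X : Finset α) (m j : ℕ) (hj : j ≤ m) (g : Finset α → ℝ) :
    ∑ D ∈ powersetCard m X, ∑ T ∈ powersetCard j D, g T =
      ((X.card - j).choose (m - j) : ℝ) * ∑ T ∈ powersetCard j X, g T := by
  rw [Finset.sum_comm' (t' := powersetCard j X)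
    (s' := fun T => (powersetCard m X).filter (T ⊆ ·))]
  · rw [Finset.mul_sum]
    apply Finset.sum_congr rfl
    intro T hT
    rw [mem_powersetCard] at hT
    rw [Finset.sum_const, nsmul_eq_mul]
    congr 2
    have : ((powersetCard m X).filter (T ⊆ ·)).card = (powersetCard (m - j) (X \ T)).card := by
      apply Finset.card_nbij' (fun D => D \ T) (fun D => D ∪ T)
      · intro D hD
        simp only [coe_filter, Set.mem_ofPred_eq, mem_powersetCard] at hD
        simp only [mem_coe, mem_powersetCard]
        exact ⟨sdiff_subset_sdiff hD.1.1 (le_refl _),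
          by rw [card_sdiff_of_subset hD.2, hD.1.2, hT.2]⟩
      · intro D hD
        simp only [mem_coe, mem_powersetCard, subset_sdiff] at hD
        simp only [coe_filter, Set.mem_ofPred_eq, mem_powersetCard]
        refine ⟨⟨union_subset hD.1.1 hT.1, ?_⟩, subset_union_right⟩
        rw [card_union_of_disjoint hD.1.2, hD.2, hT.2]; omega
      · intro D hD
        simp only [coe_filter, Set.mem_ofPred_eq, mem_powersetCard] at hD
        exact sdiff_union_of_subset hD.2
      · intro D hD
        simp only [mem_coe, mem_powersetCard, subset_sdiff] at hD
        exact union_sdiff_cancel_right hD.1.2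
    rw [this, card_powersetCard, card_sdiff_of_subset hT.1, hT.2]
  · intro D T
    simp only [mem_powersetCard, mem_filter]
    constructor
    · rintro ⟨⟨h1, h2⟩, h3, h4⟩
      exact ⟨⟨⟨h1, h2⟩, h3⟩, h3.trans h1, h4⟩
    · tauto

theorem unif_nil_empty (D : Finset α) : Unif D [] ∅ := by
  intro g; simp [E, avg, act]

theorem unif_nil_self (D : Finset α) : Unif D [] D := by
  intro g; simp [E, avg, act_one]

theorem unif_step {D S : Finset α} {L : List (α × α × ℝ)} {a : α} (l : List α)
    (haD : a ∉ D) (hl : l.Nodup) (hlD : l.toFinset = D) (hL : InD L D)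
    (hS : S ⊆ insert a D) (hU : Unif D L (S.erase a)) :
    Unif (insert a D) (L ++ chain a l) S := by
  intro g
  have hlen : l.length = D.card := by rw [← hlD, List.toFinset_card_of_nodup hl]
  have hal : a ∉ l := by rw [← hlD] at haD; simpa using haD
  have hnd : (a :: l).Nodup := List.nodup_cons.2 ⟨hal, hl⟩
  have hCin : InD (chain a l) (insert a D) := hlD ▸ chain_inD a l
  have hact : ∀ π : Perm α, (∀ x, x ∉ insert a D → π x = x) →
      act π D = (insert a D).erase (π a) := by
    intro π hπ
    have h1 : act π (insert a D) = insert a D := fix_act hπ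
    rw [act_insert] at h1
    rw [← h1, erase_insert]
    rw [mem_act]; simpa using haD
  have hc' : (insert a D).card = D.card + 1 := card_insert_of_notMem haD
  rw [E_append, E_comm]
  by_cases haS : a ∈ S
  · obtain ⟨S', haS', rfl⟩ : ∃ S', a ∉ S' ∧ S = insert a S' :=
      ⟨S.erase a, by simp, (insert_erase haS).symm⟩
    rw [erase_insert haS'] at hU
    have hS'D : S' ⊆ D := by
      intro x hx
      have := hS (mem_insert_of_mem hx)
      rw [mem_insert] at this
      rcases this with rfl | h
      · exact absurd hx haS'
      · exact h
    have hle : S'.card ≤ D.card := card_le_card hS'D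
    let H : α → ℝ := fun x =>
      (∑ T ∈ powersetCard S'.card ((insert a D).erase x), g (insert x T)) / (D.card.choose S'.card : ℝ)
    have key : E (chain a l) (fun π => E L (fun σ => g (act (π * σ) (insert a S')))) =
        E (chain a l) (fun π => H (π a)) := by
      apply E_congr hCin
      intro π hπ
      have h1 : E L (fun σ => g (act (π * σ) (insert a S'))) =
          E L (fun σ => (fun T => g (insert (π a) (act π T))) (act σ S')) := by
        apply E_congr hL
        intro σ hσ
        simp only [act_mul, act_insert, Perm.mul_apply, hσ a haD]
      rw [h1, hU (fun T => g (insert (π a) (act π T))), avg]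
      simp only [H]
      rw [← hact π hπ, ← sum_powersetCard_act π D _ (fun T => g (insert (π a) T))]
    rw [key, chain_unif a l hnd H, hlD]
    simp only [H, ← Finset.sum_div]
    rw [dc2, avg, card_insert_of_notMem haS', hc', hlen]
    have hn := Nat.add_one_mul_choose_eq D.card S'.card
    have hn' : ((D.card : ℝ) + 1) * (D.card.choose S'.card : ℝ) =
      ((D.card + 1).choose (S'.card + 1) : ℝ) * ((S'.card : ℝ) + 1) := by exact_mod_cast hn
    have p1 : ((D.card.choose S'.card : ℕ) : ℝ) ≠ 0 := by
      exact_mod_cast (Nat.choose_pos hle).ne'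
    have p2 : (((D.card + 1).choose (S'.card + 1) : ℕ) : ℝ) ≠ 0 := by
      exact_mod_cast (Nat.choose_pos (by omega)).ne'
    have p3 : (D.card : ℝ) + 1 ≠ 0 := by positivity
    rw [div_div, div_eq_div_iff (mul_ne_zero p1 p3) p2]
    linear_combination (-(∑ T ∈ powersetCard (S'.card + 1) (insert a D), g T)) * hn'
  · rw [erase_eq_of_notMem haS] at hU
    have hSD : S ⊆ D := (subset_insert_iff_of_notMem haS).1 hS
    have hle : S.card ≤ D.card := card_le_card hSD
    let H : α → ℝ := fun x =>
      (∑ T ∈ powersetCard S.card ((insert a D).erase x), g T) / (D.card.choose S.card : ℝ)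
    have key : E (chain a l) (fun π => E L (fun σ => g (act (π * σ) S))) =
        E (chain a l) (fun π => H (π a)) := by
      apply E_congr hCin
      intro π hπ
      have h1 : E L (fun σ => g (act (π * σ) S)) =
          E L (fun σ => (fun T => g (act π T)) (act σ S)) := by
        simp only [act_mul]
      rw [h1, hU (fun T => g (act π T)), avg]
      simp only [H]
      rw [← hact π hπ, ← sum_powersetCard_act π D _ g]
    rw [key, chain_unif a l hnd H, hlD]
    simp only [H, ← Finset.sum_div]
    rw [dc1 _ _ (by omega), avg, hc', hlen]
    have hn := Nat.choose_mul_succ_eq D.card S.card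
    have hn' : (D.card.choose S.card : ℝ) * ((D.card : ℝ) + 1) =
      ((D.card + 1).choose S.card : ℝ) * (((D.card + 1 : ℕ) : ℝ) - S.card) := by
      rw [← Nat.cast_sub (by omega)]
      exact_mod_cast hn
    have p1 : ((D.card.choose S.card : ℕ) : ℝ) ≠ 0 := by
      exact_mod_cast (Nat.choose_pos hle).ne'
    have p2 : (((D.card + 1).choose S.card : ℕ) : ℝ) ≠ 0 := by
      exact_mod_cast (Nat.choose_pos (by omega)).ne'
    have p3 : (D.card : ℝ) + 1 ≠ 0 := by positivity
    rw [div_div, div_eq_div_iff (mul_ne_zero p1 p3) p2]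
    linear_combination (-(∑ T ∈ powersetCard S.card (insert a D), g T)) * hn'

theorem unif_trans {D X S : Finset α} {L M : List (α × α × ℝ)} (hSD : S ⊆ D) (hDX : D ⊆ X)
    (hL : Unif D L S) (hM : Unif X M D) : Unif X (L ++ M) S := by
  intro g
  have hj : S.card ≤ D.card := card_le_card hSD
  have hm : D.card ≤ X.card := card_le_card hDX
  rw [E_append]
  simp only [act_mul]
  rw [hL (fun T => E M (fun π => g (act π T))), avg, ← E_sum]
  simp only [sum_powersetCard_act]
  rw [hM (fun D' => ∑ T ∈ powersetCard S.card D', g T), avg, avg, dc3 _ _ _ hj]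
  have h := Nat.choose_mul (n := X.card) hj
  have h' : (X.card.choose D.card : ℝ) * (D.card.choose S.card : ℝ) =
    (X.card.choose S.card : ℝ) * ((X.card - S.card).choose (D.card - S.card) : ℝ) := by
    exact_mod_cast h
  have p1 : ((X.card.choose D.card : ℕ) : ℝ) ≠ 0 := by
    exact_mod_cast (Nat.choose_pos hm).ne'
  have p2 : ((D.card.choose S.card : ℕ) : ℝ) ≠ 0 := by
    exact_mod_cast (Nat.choose_pos hj).ne'
  have p3 : ((X.card.choose S.card : ℕ) : ℝ) ≠ 0 := by
    exact_mod_cast (Nat.choose_pos (hj.trans hm)).ne'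
  rw [div_div, div_eq_div_iff (mul_ne_zero p1 p2) p3, h']
  ring

/-- Validity of all the transpositions in a list. -/
def Val {α : Type*} (L : List (α × α × ℝ)) : Prop :=
  ∀ e ∈ L, e.1 ≠ e.2.1 ∧ 0 ≤ e.2.2 ∧ e.2.2 ≤ 1

theorem Val.append {L M : List (α × α × ℝ)} (hL : Val L) (hM : Val M) : Val (L ++ M) := by
  intro e he
  rcases List.mem_append.1 he with h | h
  · exact hL e h
  · exact hM e h

theorem Val.map {L : List (α × α × ℝ)} (hL : Val L) (f : α → β) (hf : Function.Injective f) :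
    Val (L.map (fun e => (f e.1, f e.2.1, e.2.2))) := by
  intro e he
  rw [List.mem_map] at he
  obtain ⟨e', he', rfl⟩ := he
  have := hL e' he'
  exact ⟨fun h => this.1 (hf h), this.2⟩

theorem InD.mono {L : List (α × α × ℝ)} {D D' : Finset α} (h : InD L D) (hD : D ⊆ D') :
    InD L D' := fun e he => ⟨hD (h e he).1, hD (h e he).2⟩

theorem InD.append {L M : List (α × α × ℝ)} {D : Finset α} (hL : InD L D) (hM : InD M D) :
    InD (L ++ M) D := by
  intro e he
  rcases List.mem_append.1 he with h | h
  · exact hL e h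
  · exact hM e h

theorem exists_unif (D : Finset α) :
    ∃ L : List (α × α × ℝ), Val L ∧ InD L D ∧ ∀ S ⊆ D, Unif D L S := by
  induction D using Finset.induction_on with
  | empty =>
    refine ⟨[], by simp [Val], by simp [InD], ?_⟩
    intro S hS
    rw [subset_empty.1 hS]
    exact unif_nil_empty _
  | insert a D ha ih =>
    obtain ⟨L, hv, hin, hU⟩ := ih
    refine ⟨L ++ chain a D.toList, hv.append (chain_valid _ _ (by simpa using ha)),
      (hin.mono (subset_insert _ _)).append ?_, ?_⟩
    · simpa using chain_inD a D.toList
    · intro S hS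
      exact unif_step D.toList ha D.nodup_toList (by simp) hin hS
        (hU _ (by rwa [← subset_insert_iff]))

/-- The shuffle of two counters. -/
noncomputable def two {α : Type*} (a b : α) (D : Finset α) : List (α × α × ℝ) :=
  chain b D.toList ++ chain a (b :: D.toList)

theorem two_length (a b : α) (D : Finset α) : (two a b D).length = 2 * D.card + 1 := by
  simp [two, chain_length]; ring

theorem two_val {a b : α} {D : Finset α} (hab : a ≠ b) (ha : a ∉ D) (hb : b ∉ D) :
    Val (two a b D) :=
  Val.append (chain_valid _ _ (by simpa using hb)) (chain_valid _ _ (by simp [hab, ha]))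

theorem two_unif {a b : α} {D S : Finset α} (hab : a ≠ b) (ha : a ∉ D) (hb : b ∉ D)
    (hS : S ⊆ insert a (insert b D)) (h : (S.erase a).erase b = ∅ ∨ (S.erase a).erase b = D) :
    Unif (insert a (insert b D)) (two a b D) S := by
  apply unif_step
  · simp [hab, ha]
  · simp [hb, D.nodup_toList]
  · simp
  · simpa using chain_inD b D.toList
  · exact hS
  · have : Unif (insert b D) ([] ++ chain b D.toList) (S.erase a) := by
      apply unif_step
      · exact hb
      · exact D.nodup_toList
      · simp
      · simp [InD]
      · rwa [← subset_insert_iff]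
      · rcases h with h | h <;> rw [h]
        · exact unif_nil_empty _
        · exact unif_nil_self _
    simpa using this

/-- Half-half swaps within columns. -/
noncomputable def cols {α : Type*} (l : List α) : List ((α ⊕ α) × (α ⊕ α) × ℝ) :=
  l.map (fun i => (Sum.inl i, Sum.inr i, 1 / 2))

theorem cols_val (l : List α) : Val (cols l) := by
  intro e he
  simp only [cols, List.mem_map] at he
  obtain ⟨i, _, rfl⟩ := he
  refine ⟨by simp, by norm_num, by norm_num⟩

/-- column of a position -/
def col {α : Type*} : α ⊕ α → α := Sum.elim id id

theorem mem_act_swap (i : α) (S : Finset (α ⊕ α)) (x : α ⊕ α) :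
    x ∈ act (swap (Sum.inl i) (Sum.inr i)) S ↔ (if col x = i then x.swap ∈ S else x ∈ S) := by
  rw [mem_act, symm_swap]
  rcases x with y | y
  · by_cases h : y = i
    · subst h; simp [col]
    · rw [swap_apply_of_ne_of_ne (by simpa using h) (by simp)]; simp [col, h]
  · by_cases h : y = i
    · subst h; simp [col]
    · rw [swap_apply_of_ne_of_ne (by simp) (by simpa using h)]; simp [col, h]

theorem cols_flip (l : List α) (hl : l.Nodup) (g : Finset (α ⊕ α) → ℝ) (S S' : Finset (α ⊕ α))
    (h : ∀ x, x ∈ S' ↔ (if col x ∈ l then x.swap ∈ S else x ∈ S)) :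
    E (cols l) (fun σ => g (act σ S)) = E (cols l) (fun σ => g (act σ S')) := by
  induction l generalizing S S' with
  | nil =>
    have : S' = S := by ext x; simp [h]
    rw [this]
  | cons i l ih =>
    rw [List.nodup_cons] at hl
    have hcs : ∀ x : α ⊕ α, col x.swap = col x := by rintro (x | x) <;> rfl
    have e1 := ih hl.2 (act (swap (Sum.inl i) (Sum.inr i)) S) S' (by
      intro x
      rw [h, mem_act_swap, mem_act_swap, hcs, Sum.swap_swap]
      by_cases h1 : col x = i
      · simp [h1, hl.1]
      · simp [h1])
    have e2 := ih hl.2 S (act (swap (Sum.inl i) (Sum.inr i)) S') (by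
      intro x
      rw [mem_act_swap, h, h, hcs, Sum.swap_swap]
      by_cases h1 : col x = i
      · simp [h1, hl.1]
      · simp [h1])
    have c : ∀ T : Finset (α ⊕ α), E (cols (i :: l)) (fun σ => g (act σ T)) =
        1 / 2 * E (cols l) (fun σ => g (act σ (act (swap (Sum.inl i) (Sum.inr i)) T))) +
        (1 - 1 / 2) * E (cols l) (fun σ => g (act σ T)) := by
      intro T
      simp only [cols, List.map_cons, E, act_mul]
    rw [c, c, e1, e2]
    ring

theorem E_inl (L : List (α × α × ℝ)) (f : Finset (α ⊕ α) → ℝ) (A B : Finset α) :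
    E (L.map (fun e => ((Sum.inl e.1 : α ⊕ α), (Sum.inl e.2.1 : α ⊕ α), e.2.2)))
      (fun σ => f (act σ (A.disjSum B))) = E L (fun σ => f ((act σ A).disjSum B)) := by
  rw [E_map (f := (Sum.inl : α → α ⊕ α)) (φ := fun σ => Perm.sumCongr σ 1)]
  · congr 1
    funext σ
    congr 1
    ext x
    rcases x with x | x <;> (simp [mem_act]; try rfl)
  · exact Perm.sumCongr_one
  · intro σ τ; simp [Perm.sumCongr_mul]
  · intro a b; exact Perm.sumCongr_swap_one a b

theorem E_inr (L : List (α × α × ℝ)) (f : Finset (α ⊕ α) → ℝ) (A B : Finset α) :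
    E (L.map (fun e => ((Sum.inr e.1 : α ⊕ α), (Sum.inr e.2.1 : α ⊕ α), e.2.2)))
      (fun σ => f (act σ (A.disjSum B))) = E L (fun σ => f (A.disjSum (act σ B))) := by
  rw [E_map (f := (Sum.inr : α → α ⊕ α)) (φ := fun σ => Perm.sumCongr 1 σ)]
  · congr 1
    funext σ
    congr 1
    ext x
    rcases x with x | x <;> (simp [mem_act]; try rfl)
  · exact Perm.sumCongr_one
  · intro σ τ; simp [Perm.sumCongr_mul]
  · intro a b; exact Perm.sumCongr_one_swap a b

/-- Sum over pairs of subsets of given sizes. -/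
noncomputable def SS {α : Type*} [Fintype α] (h : Finset (α ⊕ α) → ℝ) (i j : ℕ) : ℝ :=
  ∑ A ∈ powersetCard i (univ : Finset α), ∑ B ∈ powersetCard j (univ : Finset α), h (A.disjSum B)

theorem sum_split [Fintype α] (h : Finset (α ⊕ α) → ℝ) :
    ∑ S ∈ powersetCard 4 (univ : Finset (α ⊕ α)), h S =
      SS h 0 4 + SS h 1 3 + SS h 2 2 + SS h 3 1 + SS h 4 0 := by
  have : ∑ S ∈ powersetCard 4 (univ : Finset (α ⊕ α)), h S = ∑ j ∈ range 5, SS h j (4 - j) := by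
    simp only [SS, ← Finset.sum_product']
    rw [Finset.sum_sigma']
    apply Finset.sum_nbij' (fun S => ⟨S.toLeft.card, (S.toLeft, S.toRight)⟩)
      (fun x => x.2.1.disjSum x.2.2)
    · intro S hS
      have := card_toLeft_add_card_toRight (u := S)
      simp only [mem_powersetCard] at hS
      simp only [mem_sigma, mem_range, mem_product, mem_powersetCard, subset_univ, true_and]
      omega
    · rintro ⟨j, A, B⟩ hx
      simp only [mem_sigma, mem_range, mem_product, mem_powersetCard, subset_univ, true_and] at hx
      simp only [mem_powersetCard, subset_univ, true_and, card_disjSum]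
      omega
    · intro S _
      exact toLeft_disjSum_toRight
    · rintro ⟨j, A, B⟩ hx
      simp only [mem_sigma, mem_range, mem_product, mem_powersetCard, subset_univ, true_and] at hx
      simp [hx.2.1]
    · intro S _
      simp [toLeft_disjSum_toRight]
  rw [this]
  simp [Finset.sum_range_succ]

theorem SS_flip [Fintype α] (h : Finset (α ⊕ α) → ℝ)
    (hf : ∀ A B : Finset α, h (A.disjSum B) = h (B.disjSum A)) (i j : ℕ) :
    SS h i j = SS h j i := by
  rw [SS, Finset.sum_comm, SS]
  simp only [hf]

theorem mid [Fintype α] {L M : List (α × α × ℝ)} {A B : Finset α} (hL : Unif univ L A)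
    (hM : Unif univ M B) (h : Finset (α ⊕ α) → ℝ) :
    E (L.map (fun e => ((Sum.inl e.1 : α ⊕ α), (Sum.inl e.2.1 : α ⊕ α), e.2.2)) ++
       M.map (fun e => ((Sum.inr e.1 : α ⊕ α), (Sum.inr e.2.1 : α ⊕ α), e.2.2)))
      (fun σ => h (act σ (A.disjSum B))) =
    SS h A.card B.card /
      (((Fintype.card α).choose A.card : ℝ) * ((Fintype.card α).choose B.card : ℝ)) := by
  rw [E_append]
  simp only [act_mul]
  rw [E_inl L (fun T => E (M.map (fun e =>
    ((Sum.inr e.1 : α ⊕ α), (Sum.inr e.2.1 : α ⊕ α), e.2.2))) (fun π => h (act π T)))]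
  simp only [E_inr]
  rw [hL (fun A' => E M (fun σ => h (A'.disjSum (act σ B))))]
  have : ∀ A' : Finset α, E M (fun σ => h (A'.disjSum (act σ B))) =
      avg univ B.card (fun B' => h (A'.disjSum B')) :=
    fun A' => hM (fun B' => h (A'.disjSum B'))
  simp only [this, avg, ← Finset.sum_div, div_div, card_univ]
  rw [mul_comm]
  rfl

theorem probs (q2 q3 q4 : ℝ) (h2 : 0 ≤ q2) (h3 : 0 ≤ q3) (h4 : 0 ≤ q4) (hs : q2 + q3 + q4 = 1)
    (hd : 4 * q2 * q4 ≤ q3 ^ 2) : ∃ a b : ℝ, 0 ≤ a ∧ a ≤ 1 ∧ 0 ≤ b ∧ b ≤ 1 ∧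
      a * b = q2 ∧ a * (1 - b) + (1 - a) * b = q3 ∧ (1 - a) * (1 - b) = q4 := by
  have hD : 0 ≤ q3 ^ 2 - 4 * q2 * q4 := by linarith
  set r := Real.sqrt (q3 ^ 2 - 4 * q2 * q4) with hr
  have hr2 : r ^ 2 = q3 ^ 2 - 4 * q2 * q4 := Real.sq_sqrt hD
  have hr0 : 0 ≤ r := Real.sqrt_nonneg _
  have hr3 : r ≤ q3 := by
    apply abs_le_of_sq_le_sq' _ h3 |>.2
    nlinarith [mul_nonneg h2 h4]
  have hq4 : q4 = 1 - q2 - q3 := by linarith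
  subst hq4
  refine ⟨(q3 + 2 * q2 + r) / 2, (q3 + 2 * q2 - r) / 2, ?_, ?_, ?_, ?_, ?_, ?_, ?_⟩
  · linarith
  · linarith
  · linarith
  · linarith
  · nlinarith
  · nlinarith
  · nlinarith

theorem sum_inv [Fintype α] (L : List (α × α × ℝ)) (t : ℕ) (g : Finset α → ℝ) :
    ∑ S ∈ powersetCard t (univ : Finset α), E L (fun σ => g (act σ S)) =
      ∑ S ∈ powersetCard t (univ : Finset α), g S := by
  rw [← E_sum]
  simp only [sum_powersetCard_act]
  have : ∀ σ : Perm α, act σ univ = univ := by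
    intro σ; simp [act]
  simp only [this, E_const]

theorem SS_one [Fintype α] (i j : ℕ) : SS (fun _ : Finset (α ⊕ α) => 1) i j =
    ((Fintype.card α).choose i : ℝ) * ((Fintype.card α).choose j : ℝ) := by
  simp [SS]

theorem choose_ineq (k : ℕ) (hk : 4 ≤ k) :
    2 * (k.choose 2 : ℝ) ^ 2 * (k.choose 4 : ℝ) ≤ (k.choose 3 : ℝ) ^ 2 * (k : ℝ) ^ 2 := by
  have hk' : (4 : ℝ) ≤ k := by exact_mod_cast hk
  have h2 : (k.choose 2 : ℝ) = k * (k - 1) / 2 := Nat.cast_choose_two ℝ k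
  have h3 : (k.choose 3 : ℝ) * 3 = k.choose 2 * (k - 2) := by
    have := Nat.choose_succ_right_eq k 2
    have h : ((k - 2 : ℕ) : ℝ) = k - 2 := by rw [Nat.cast_sub (by omega)]; norm_num
    rw [← h]; exact_mod_cast this
  have h4 : (k.choose 4 : ℝ) * 4 = k.choose 3 * (k - 3) := by
    have := Nat.choose_succ_right_eq k 3
    have h : ((k - 3 : ℕ) : ℝ) = k - 3 := by rw [Nat.cast_sub (by omega)]; norm_num
    rw [← h]; exact_mod_cast this
  have e3 : (k.choose 3 : ℝ) = k.choose 2 * (k - 2) / 3 := by linarith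
  have e4 : (k.choose 4 : ℝ) = k.choose 3 * (k - 3) / 4 := by linarith
  have p2 : (0 : ℝ) ≤ k.choose 2 := by positivity
  have hkey : (k : ℝ) * (k - 1) / 2 * (k - 3) / 2 ≤ (k - 2) * k ^ 2 / 3 := by
    nlinarith [mul_nonneg (by linarith : (0 : ℝ) ≤ k) (by nlinarith : (0 : ℝ) ≤ (k : ℝ) ^ 2 + 4 * k - 9)]
  have hc : 0 ≤ (k.choose 2 : ℝ) ^ 2 * (k.choose 3 : ℝ) := by positivity
  have := mul_le_mul_of_nonneg_left hkey hc
  calc 2 * (k.choose 2 : ℝ) ^ 2 * (k.choose 4 : ℝ)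
      = (k.choose 2 : ℝ) * (k.choose 3 : ℝ) * (k.choose 2 * (k - 3) / 2) := by rw [e4]; ring
    _ ≤ (k.choose 2 : ℝ) * (k.choose 3 : ℝ) * ((k - 2) * k ^ 2 / 3) := by
        apply mul_le_mul_of_nonneg_left _ (by positivity)
        rw [h2]; exact hkey
    _ = (k.choose 3 : ℝ) ^ 2 * (k : ℝ) ^ 2 := by
        rw [sq (k.choose 3 : ℝ)]; nth_rw 3 [e3]; ring

theorem core [Fintype α] (k : ℕ) (hc : Fintype.card α = k) (hk : 4 ≤ k) (a0 a1 a2 a3 : α)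
    (h01 : a0 ≠ a1) (h02 : a0 ≠ a2) (h03 : a0 ≠ a3) (h12 : a1 ≠ a2) (h13 : a1 ≠ a3)
    (h23 : a2 ≠ a3) (L3 : List (α × α × ℝ)) (hv3 : Val L3)
    (hU3 : Unif univ L3 {a0, a1, a2, a3}) :
    ∃ L : List ((α ⊕ α) × (α ⊕ α) × ℝ), Val L ∧ L.length = 3 * k + 4 + L3.length ∧
      Unif univ L (({a0, a1, a2, a3} : Finset α).disjSum ∅) := by
  -- probabilities
  have hN := sum_split (α := α) (fun _ => 1)
  simp only [SS_one, sum_const, card_powersetCard, card_univ, nsmul_eq_mul, mul_one, hc,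
    Fintype.card_sum, Nat.choose_zero_right, Nat.choose_one_right, Nat.cast_one, one_mul] at hN
  have pN : (0 : ℝ) < ((k + k).choose 4 : ℕ) := by
    exact_mod_cast Nat.choose_pos (by omega)
  set N : ℝ := (((k + k).choose 4 : ℕ) : ℝ) with hNdef
  obtain ⟨p, q, hp0, hp1, hq0, hq1, e2, e3, e4⟩ := probs
    ((k.choose 2 : ℝ) ^ 2 / N) (2 * (k.choose 3 : ℝ) * k / N) (2 * (k.choose 4 : ℝ) / N)
    (by positivity) (by positivity) (by positivity)
    (by rw [← add_div, ← add_div, div_eq_one_iff_eq pN.ne', hN]; ring)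
    (by
      have := choose_ineq k hk
      rw [div_pow, show 4 * ((k.choose 2 : ℝ) ^ 2 / N) * (2 * (k.choose 4 : ℝ) / N) =
        4 * (2 * (k.choose 2 : ℝ) ^ 2 * (k.choose 4 : ℝ)) / N ^ 2 by field_simp]
      apply div_le_div_of_nonneg_right _ (by positivity)
      nlinarith)
  have hD4 : ({a0, a1, a2, a3} : Finset α) = insert a0 (insert a1 {a2, a3}) := rfl
  let L2 := two a0 a1 ({a2, a3} : Finset α)
  let B0 : Finset α := univ \ {a0, a1}
  let L4 := two a0 a1 B0
  have hB0 : insert a0 (insert a1 B0) = univ := by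
    ext x; simp only [B0, mem_insert, mem_sdiff, mem_univ, mem_singleton]; tauto
  let inl' : List (α × α × ℝ) → List ((α ⊕ α) × (α ⊕ α) × ℝ) :=
    List.map (fun e => ((Sum.inl e.1 : α ⊕ α), (Sum.inl e.2.1 : α ⊕ α), e.2.2))
  let inr' : List (α × α × ℝ) → List ((α ⊕ α) × (α ⊕ α) × ℝ) :=
    List.map (fun e => ((Sum.inr e.1 : α ⊕ α), (Sum.inr e.2.1 : α ⊕ α), e.2.2))
  let M := inl' (L2 ++ L3) ++ inr' L4
  let C := cols (univ : Finset α).toList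
  have hUA : ∀ A ⊆ ({a0, a1, a2, a3} : Finset α), (A.erase a0).erase a1 = {a2, a3} →
      Unif univ (L2 ++ L3) A := by
    intro A hA h
    refine unif_trans hA (subset_univ _) ?_ hU3
    rw [hD4]
    exact two_unif h01 (by simp [h02, h03]) (by simp [h12, h13]) hA (Or.inr h)
  have hUB : ∀ B : Finset α, (B.erase a0).erase a1 = ∅ → Unif univ L4 B := by
    intro B h
    rw [← hB0]
    exact two_unif h01 (by simp [B0]) (by simp [B0]) (by rw [hB0]; simp) (Or.inl h)
  refine ⟨[(Sum.inl a0, Sum.inr a0, p), (Sum.inl a1, Sum.inr a1, q)] ++ (M ++ C), ?_, ?_, ?_⟩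
  · refine Val.append ?_ (Val.append (Val.append ?_ ?_) (cols_val _))
    · intro e he
      simp only [List.mem_cons, List.not_mem_nil, or_false] at he
      rcases he with rfl | rfl
      · exact ⟨by simp, hp0, hp1⟩
      · exact ⟨by simp, hq0, hq1⟩
    · exact Val.map ((two_val h01 (by simp [h02, h03]) (by simp [h12, h13])).append hv3) _
        Sum.inl_injective
    · exact Val.map (two_val h01 (by simp [B0]) (by simp [B0])) _ Sum.inr_injective
  · have c1 : B0.card = k - 2 := by
      rw [card_sdiff_of_subset (subset_univ _), card_univ, hc, card_pair h01]
    have c2 : ({a2, a3} : Finset α).card = 2 := card_pair h23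
    simp only [M, C, inl', inr', L2, L4, cols, List.length_append, List.length_map,
      List.length_cons, List.length_nil, two_length, c1, c2, length_toList, card_univ, hc]
    omega
  · intro g
    let h : Finset (α ⊕ α) → ℝ := fun S => E C (fun σ => g (act σ S))
    have hflip : ∀ A B : Finset α, h (A.disjSum B) = h (B.disjSum A) := by
      intro A B
      apply cols_flip _ (nodup_toList _)
      rintro (x | x) <;> simp
    have hsum : ∑ S ∈ powersetCard 4 (univ : Finset (α ⊕ α)), g S =
        SS h 2 2 + 2 * SS h 3 1 + 2 * SS h 4 0 := by
      rw [← sum_inv C, sum_split, SS_flip h hflip 0 4, SS_flip h hflip 1 3]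
      ring
    have hM : ∀ A B : Finset α, A ⊆ ({a0, a1, a2, a3} : Finset α) →
        (A.erase a0).erase a1 = {a2, a3} → (B.erase a0).erase a1 = ∅ →
        E M (fun σ => h (act σ (A.disjSum B))) =
          SS h A.card B.card / ((k.choose A.card : ℝ) * (k.choose B.card : ℝ)) := by
      intro A B h1 h2 h3
      have := mid (hUA A h1 h2) (hUB B h3) h
      rw [hc] at this
      exact this
    have s0 : act (swap (Sum.inl a0) (Sum.inr a0)) (({a0, a1, a2, a3} : Finset α).disjSum ∅) =
        ({a1, a2, a3} : Finset α).disjSum {a0} := by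
      ext x
      rw [mem_act_swap]
      rcases x with x | x <;> simp [col] <;> grind
    have s1 : act (swap (Sum.inl a1) (Sum.inr a1)) (({a0, a1, a2, a3} : Finset α).disjSum ∅) =
        ({a0, a2, a3} : Finset α).disjSum {a1} := by
      ext x
      rw [mem_act_swap]
      rcases x with x | x <;> simp [col] <;> grind
    have s01 : act (swap (Sum.inl a1) (Sum.inr a1)) (({a1, a2, a3} : Finset α).disjSum {a0}) =
        ({a2, a3} : Finset α).disjSum {a0, a1} := by
      ext x
      rw [mem_act_swap]
      rcases x with x | x <;> simp [col] <;> grind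
    have c4 : ({a0, a1, a2, a3} : Finset α).card = 4 := by
      simp [card_insert_of_notMem, h01, h02, h03, h12, h13, h23]
    have c3 : ({a1, a2, a3} : Finset α).card = 3 := by
      simp [card_insert_of_notMem, h12, h13, h23]
    have c3' : ({a0, a2, a3} : Finset α).card = 3 := by
      simp [card_insert_of_notMem, h02, h03, h23]
    have m40 := hM {a0, a1, a2, a3} ∅ (by simp) (by ext x; simp; grind) (by simp)
    have m31 := hM {a1, a2, a3} {a0} (by intro x; simp; tauto) (by ext x; simp; grind)
      (by simp)
    have m31' := hM {a0, a2, a3} {a1} (by intro x; simp; tauto) (by ext x; simp; grind)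
      (by ext x; simp; tauto)
    have m22 := hM {a2, a3} {a0, a1} (by intro x; simp; tauto) (by ext x; simp; grind)
      (by ext x; simp; grind)
    rw [c4, card_empty] at m40
    rw [c3, card_singleton] at m31
    rw [c3', card_singleton] at m31'
    rw [card_pair h23, card_pair h01] at m22
    rw [avg, card_disjSum, c4, card_empty, Nat.add_zero, hsum, card_univ, Fintype.card_sum, hc,
      ← hNdef, ← List.append_assoc, E_append]
    have hh : E ([(Sum.inl a0, Sum.inr a0, p), (Sum.inl a1, Sum.inr a1, q)] ++ M)
        (fun σ => E C (fun π => g (act (π * σ) (({a0, a1, a2, a3} : Finset α).disjSum ∅)))) =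
        E ([(Sum.inl a0, Sum.inr a0, p), (Sum.inl a1, Sum.inr a1, q)] ++ M)
        (fun σ => h (act σ (({a0, a1, a2, a3} : Finset α).disjSum ∅))) := by
      simp only [h, act_mul]
    rw [hh]
    simp only [List.cons_append, List.nil_append, E, act_mul, s0, s1, s01, m40, m31, m31', m22]
    have pk : (0 : ℝ) < k := by exact_mod_cast (by omega : 0 < k)
    have p2 : (0 : ℝ) < (k.choose 2 : ℕ) := by exact_mod_cast Nat.choose_pos (by omega)
    have p3 : (0 : ℝ) < (k.choose 3 : ℕ) := by exact_mod_cast Nat.choose_pos (by omega)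
    have p4 : (0 : ℝ) < (k.choose 4 : ℕ) := by exact_mod_cast Nat.choose_pos (by omega)
    simp only [Nat.choose_zero_right, Nat.choose_one_right, Nat.cast_one, mul_one]
    have e : p * (q * (SS h 2 2 / ((k.choose 2 : ℝ) * (k.choose 2 : ℝ))) +
          (1 - q) * (SS h 3 1 / ((k.choose 3 : ℝ) * k))) +
        (1 - p) * (q * (SS h 3 1 / ((k.choose 3 : ℝ) * k)) +
          (1 - q) * (SS h 4 0 / (k.choose 4 : ℝ))) =
        (p * q) * (SS h 2 2 / ((k.choose 2 : ℝ) * (k.choose 2 : ℝ))) +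
        (p * (1 - q) + (1 - p) * q) * (SS h 3 1 / ((k.choose 3 : ℝ) * k)) +
        ((1 - p) * (1 - q)) * (SS h 4 0 / (k.choose 4 : ℝ)) := by ring
    rw [e, e2, e3, e4]
    field_simp

theorem E_eq_sum {n : ℕ} (L : List (LazyT n)) (F : Perm (Fin n) → ℝ) :
    E L F = ∑ σ : Perm (Fin n), permDist L σ * F σ := by
  induction L generalizing F with
  | nil => simp [E, permDist]
  | cons e L ih =>
    simp only [E, permDist, ih, add_mul, Finset.sum_add_distrib, Finset.mul_sum]
    congr 1
    · rw [← Equiv.sum_comp (Equiv.mulRight (swap e.1 e.2.1))]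
      apply Finset.sum_congr rfl
      intro σ _
      simp [mul_assoc]
    · apply Finset.sum_congr rfl
      intro σ _
      ring

/-- The initial set. -/
def startSet {n t : ℕ} (ht : t ≤ n) : Finset (Fin n) := univ.image (Fin.castLE ht)

theorem startSet_card {n t : ℕ} (ht : t ≤ n) : (startSet ht).card = t := by
  rw [startSet, card_image_of_injective _ (Fin.castLE_injective ht)]; simp

theorem occ_eq {n t : ℕ} (ht : t ≤ n) (L : List (LazyT n)) (S : Finset (Fin n)) :
    occProb ht L S = E L (fun σ => if act σ (startSet ht) = S then 1 else 0) := by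
  rw [E_eq_sum, occProb]
  apply Finset.sum_congr rfl
  intro σ _
  have : Finset.image (fun i : Fin t => σ (Fin.castLE ht i)) univ = act σ (startSet ht) := by
    rw [act, startSet, Finset.map_eq_image, Finset.image_image]; rfl
  rw [this]
  simp

theorem ind_iff {n t : ℕ} (ht : t ≤ n) (L : List (LazyT n)) :
    IsIndShuffle ht L ↔ Val L ∧ Unif univ L (startSet ht) := by
  constructor
  · rintro ⟨hv, hS⟩
    refine ⟨hv, ?_⟩
    intro g
    have : ∀ σ : Perm (Fin n), g (act σ (startSet ht)) = ∑ T ∈ powersetCard t (univ : Finset (Fin n)),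
        g T * (if act σ (startSet ht) = T then 1 else 0) := by
      intro σ
      simp [card_act, startSet_card]
    simp only [this]
    rw [E_sum, avg, startSet_card, Finset.sum_div]
    apply Finset.sum_congr rfl
    intro T hT
    rw [E_mul, ← occ_eq, hS T (mem_powersetCard.1 hT).2]
    simp [div_eq_mul_inv]
  · rintro ⟨hv, hU⟩
    refine ⟨hv, ?_⟩
    intro S hS
    rw [occ_eq, hU (fun T => if T = S then 1 else 0), avg, startSet_card]
    simp [hS]

theorem unif_equiv [Fintype α] [Fintype β] (e : α ≃ β) {L : List (α × α × ℝ)} {S : Finset α}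
    (h : Unif univ L S) : Unif univ (L.map (fun x => (e x.1, e x.2.1, x.2.2)))
      (S.map e.toEmbedding) := by
  intro g
  rw [E_map (f := e) (φ := fun σ => e.permCongr σ)]
  · have h1 : ∀ σ : Perm α, act (e.permCongr σ) (S.map e.toEmbedding) =
        (act σ S).map e.toEmbedding := by
      intro σ
      ext x
      simp only [mem_act, Finset.mem_map_equiv]
      simp [Equiv.permCongr_def]
    simp only [h1]
    rw [h (fun T => g (T.map e.toEmbedding)), avg, avg, card_map, card_univ, card_univ,
      Fintype.card_congr e, ← Finset.map_univ_equiv e, powersetCard_map, Finset.sum_map]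
    rfl
  · ext; simp
  · intro σ τ; ext; simp
  · intro a b
    ext x
    rw [← Equiv.symm_trans_swap_trans a b e]; rfl

end Dbl

theorem Uhat_four_doubling (k : ℕ) (hk : 4 ≤ k) :
    Uhat 4 (2 * k) ≤ 3 * k + 4 + Uhat 4 k := by
  have hne : { ℓ : ℕ | ∃ (ht : 4 ≤ k) (L : List (LazyT k)),
      L.length = ℓ ∧ IsIndShuffle ht L }.Nonempty := by
    obtain ⟨L, hv, _, hU⟩ := Dbl.exists_unif (univ : Finset (Fin k))
    exact ⟨L.length, hk, L, rfl, (Dbl.ind_iff hk L).2 ⟨hv, hU _ (subset_univ _)⟩⟩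
  obtain ⟨ht, L3, hlen, hL3⟩ := Nat.sInf_mem hne
  rw [Dbl.ind_iff] at hL3
  have hstart : Dbl.startSet ht = {⟨0, by omega⟩, ⟨1, by omega⟩, ⟨2, by omega⟩, ⟨3, by omega⟩} := by
    simp [Dbl.startSet, Fin.univ_succ]
    rfl
  rw [hstart] at hL3
  obtain ⟨L, hv, hl, hU⟩ := Dbl.core k (Fintype.card_fin k) hk _ _ _ _ (by simp) (by simp)
    (by simp) (by simp) (by simp) (by simp) L3 hL3.1 hL3.2
  have hU' := Dbl.unif_equiv (finSumFinEquiv.trans (finCongr (two_mul k).symm)) hU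
  have h2 : 4 ≤ 2 * k := by omega
  apply Nat.sInf_le
  refine ⟨h2, _, ?_, (Dbl.ind_iff h2 _).2 ⟨Dbl.Val.map hv _ (Equiv.injective
    (finSumFinEquiv.trans (finCongr (two_mul k).symm))), ?_⟩⟩
  · rw [List.length_map, hl, hlen]; rfl
  · convert hU' using 1
    rw [Finset.disjSum_empty]
    simp [Dbl.startSet, Fin.univ_succ, Finset.map_insert]
    rfl
end
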